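/- For every integer r ≥ 4 there exists a constant Δ₀ such that for every graph G with maximum degree Δ ≥ Δ₀ and minimum degree δ ≥ (ln Δ)^8, the r-distant sum distinguishing index satisfies χ'_{Σ,r}(G) < 4·Δ^{r-1}·(1 + 3/(2 ln Δ)) + 384. -/

import Mathlib

open Finset

/-- A proper edge colouring of `G` with colours in `{1,…,k}` that sum-distinguishes every
pair of distinct vertices at distance at most `r`. -/
def DistSumDistinguishing {V : Type*} [Fintype V] [DecidableEq V]
    (G : SimpleGraph V) [DecidableRel G.Adj] (r k : ℕ) : Prop :=
  ∃ c : Sym2 V → ℕ,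
    (∀ e ∈ G.edgeSet, 1 ≤ c e ∧ c e ≤ k) ∧
    (∀ e₁ ∈ G.edgeSet, ∀ e₂ ∈ G.edgeSet, e₁ ≠ e₂ → (∃ v, v ∈ e₁ ∧ v ∈ e₂) → c e₁ ≠ c e₂) ∧
    (∀ u v : V, 0 < G.dist u v → G.dist u v ≤ r →
      ∑ w ∈ G.neighborFinset u, c s(u, w) ≠ ∑ w ∈ G.neighborFinset v, c s(v, w))

/-- The `r`-distant sum distinguishing index `χ'_{Σ,r}(G)`. -/
noncomputable def distSumDistIndex {V : Type*} [Fintype V] [DecidableEq V]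
    (G : SimpleGraph V) [DecidableRel G.Adj] (r : ℕ) : ℕ :=
  sInf {k | DistSumDistinguishing G r k}

section ProductCounting

variable {ι α κ : Type*} [Fintype ι] [DecidableEq ι] [Fintype α]

/-- Events depending on disjoint sets of coordinates are independent for the uniform measure. -/
theorem card_and_mul_card_of_dependsOn {A B : (ι → α) → Prop} [DecidablePred A]
    [DecidablePred B] {I J : Set ι} (hA : DependsOn A I) (hB : DependsOn B J) (hIJ : Disjoint I J) :
    #{ω | A ω ∧ B ω} * Fintype.card (ι → α) = #{ω | A ω} * #{ω | B ω} := by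
  classical
  have key : ∀ ω ω' : ι → α, (A (I.piecewise ω ω') ↔ A ω) ∧ (B (I.piecewise ω ω') ↔ B ω') := by
    intro ω ω'
    constructor
    · exact Eq.to_iff (hA fun i hi => by simp [hi])
    · refine Eq.to_iff (hB fun i hi => ?_)
      have : i ∉ I := fun h => Set.disjoint_left.1 hIJ h hi
      simp [this]
  rw [← Finset.card_univ, ← card_product, ← card_product]
  refine card_bij' (fun p _ => (I.piecewise p.1 p.2, I.piecewise p.2 p.1))
    (fun p _ => (I.piecewise p.1 p.2, I.piecewise p.2 p.1)) ?_ ?_ ?_ ?_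
  · rintro ⟨ω, ω'⟩ h
    simp only [mem_product, mem_filter, mem_univ, true_and, and_true] at h ⊢
    exact ⟨(key _ _).1.2 h.1, (key _ _).2.2 h.2⟩
  · rintro ⟨ω, ω'⟩ h
    simp only [mem_product, mem_filter, mem_univ, true_and, and_true] at h ⊢
    exact ⟨(key _ _).1.2 h.1, (key _ _).2.2 h.2⟩
  · rintro ⟨ω, ω'⟩ _
    ext i <;> by_cases hi : i ∈ I <;> simp [hi]
  · rintro ⟨ω, ω'⟩ _
    ext i <;> by_cases hi : i ∈ I <;> simp [hi]

open scoped Classical in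
theorem sum_sum_piecewise (I : Finset ι) (f : (ι → α) → ℝ) :
    ∑ ω, ∑ ω', f (I.piecewise ω' ω) = Fintype.card (ι → α) * ∑ ω, f ω := by
  have : ∑ p : (ι → α) × (ι → α), f (I.piecewise p.2 p.1)
      = ∑ p : (ι → α) × (ι → α), f p.1 := by
    refine sum_bij' (fun p _ => (I.piecewise p.2 p.1, I.piecewise p.1 p.2))
      (fun p _ => (I.piecewise p.2 p.1, I.piecewise p.1 p.2)) ?_ ?_ ?_ ?_ ?_
    · simp
    · simp
    · rintro ⟨ω, ω'⟩ _
      ext i <;> by_cases hi : i ∈ I <;> simp [hi]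
    · rintro ⟨ω, ω'⟩ _
      ext i <;> by_cases hi : i ∈ I <;> simp [hi]
    · simp
  rw [Fintype.sum_prod_type, Fintype.sum_prod_type] at this
  rw [this]
  simp [mul_sum, Finset.card_univ]

open scoped Classical in
/-- Resampling the coordinates in `I`, of which `f` is independent, bounds `∑ f g`. -/
theorem sum_mul_le_of_resample [Nonempty α] (I : Finset ι) {f g : (ι → α) → ℝ} {c : ℝ}
    (hf : ∀ ω, 0 ≤ f ω) (hfI : ∀ ω ω', f (I.piecewise ω' ω) = f ω)
    (hg : ∀ ω, ∑ ω', g (I.piecewise ω' ω) ≤ c * Fintype.card (ι → α)) :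
    ∑ ω, f ω * g ω ≤ c * ∑ ω, f ω := by
  have hpos : (0 : ℝ) < Fintype.card (ι → α) := by exact_mod_cast Fintype.card_pos
  have h1 := sum_sum_piecewise I (fun ω => f ω * g ω)
  have h2 : ∑ ω, ∑ ω', f (I.piecewise ω' ω) * g (I.piecewise ω' ω)
      ≤ ∑ ω, f ω * (c * Fintype.card (ι → α)) := by
    refine sum_le_sum fun ω _ => ?_
    simp only [hfI]
    rw [← mul_sum]
    exact mul_le_mul_of_nonneg_left (hg ω) (hf ω)
  rw [h1, ← sum_mul] at h2
  nlinarith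

open scoped Classical in
theorem sum_prod_le_pow_of_resample [Nonempty α] (U : Finset κ) (I : κ → Finset ι)
    {X : κ → (ι → α) → ℝ} {c : ℝ} (hc : 0 ≤ c) (hX : ∀ u ω, 0 ≤ X u ω)
    (hdep : ∀ u ∈ U, ∀ u' ∈ U, u ≠ u' → ∀ ω ω', X u' ((I u).piecewise ω' ω) = X u' ω)
    (havg : ∀ u ∈ U, ∀ ω, ∑ ω', X u ((I u).piecewise ω' ω) ≤ c * Fintype.card (ι → α)) :
    ∑ ω, ∏ u ∈ U, X u ω ≤ c ^ #U * Fintype.card (ι → α) := by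
  induction U using Finset.induction_on with
  | empty => simp [Finset.card_univ]
  | insert a U ha ih =>
    simp only [prod_insert ha, card_insert_of_notMem ha]
    have h := sum_mul_le_of_resample (I a) (f := fun ω => ∏ u ∈ U, X u ω) (g := X a) (c := c)
      (fun ω => prod_nonneg fun u _ => hX u ω)
      (fun ω ω' => prod_congr rfl fun u hu => hdep a (mem_insert_self _ _) u
        (mem_insert_of_mem hu) (fun h => ha (h ▸ hu)) ω ω')
      (havg a (mem_insert_self _ _))
    have ih' := ih
      (fun u hu u' hu' => hdep u (mem_insert_of_mem hu) u' (mem_insert_of_mem hu'))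
      (fun u hu => havg u (mem_insert_of_mem hu))
    calc ∑ ω, X a ω * ∏ u ∈ U, X u ω = ∑ ω, (∏ u ∈ U, X u ω) * X a ω := by
          simp only [mul_comm]
      _ ≤ c * ∑ ω, ∏ u ∈ U, X u ω := h
      _ ≤ c * (c ^ #U * Fintype.card (ι → α)) := mul_le_mul_of_nonneg_left ih' hc
      _ = _ := by ring

open scoped Classical in
/-- Exponential moment bound for the number of occurring events, valid for both tails. -/
theorem sum_exp_card_le [Nonempty α] (U : Finset κ) (I : κ → Finset ι)
    {E : κ → (ι → α) → Prop} {s p : ℝ} (hs : |s| ≤ 1) (hp : 0 ≤ p)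
    (hdep : ∀ u ∈ U, ∀ u' ∈ U, u ≠ u' → ∀ ω ω', E u' ((I u).piecewise ω' ω) ↔ E u' ω)
    (havg : ∀ u ∈ U, ∀ ω, s * #{ω' | E u ((I u).piecewise ω' ω)}
      ≤ s * (p * Fintype.card (ι → α))) :
    ∑ ω, Real.exp (s * #{u ∈ U | E u ω})
      ≤ Real.exp ((s + s ^ 2) * p * #U) * Fintype.card (ι → α) := by
  have h1 : ∀ ω, Real.exp (s * #{u ∈ U | E u ω})
      = ∏ u ∈ U, if E u ω then Real.exp s else 1 := by
    intro ω
    rw [prod_ite]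
    simp [← Real.exp_nat_mul, mul_comm]
  have h2 : Real.exp ((s + s ^ 2) * p * #U) = Real.exp ((s + s ^ 2) * p) ^ #U := by
    rw [← Real.exp_nat_mul, mul_comm]
  simp only [h1, h2]
  refine sum_prod_le_pow_of_resample U I (Real.exp_pos _).le (fun u ω => ?_) ?_ ?_
  · split_ifs <;> positivity
  · intro u hu u' hu' hne ω ω'
    simp [hdep u hu u' hu' hne ω ω']
  · intro u hu ω
    have hN : (0 : ℝ) < Fintype.card (ι → α) := by exact_mod_cast Fintype.card_pos
    have e1 : ∀ ω' : ι → α, (if E u ((I u).piecewise ω' ω) then Real.exp s else 1)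
        = 1 + (Real.exp s - 1) * (if E u ((I u).piecewise ω' ω) then 1 else 0) := by
      intro ω'; split_ifs <;> ring
    simp only [e1, sum_add_distrib, ← mul_sum, sum_boole]
    have hexp : Real.exp s ≤ 1 + s + s ^ 2 := by
      have := Real.abs_exp_sub_one_sub_id_le hs
      have := (abs_le.1 this).2
      linarith
    have hlow : 1 + s ≤ Real.exp s := by linarith [Real.add_one_le_exp s]
    set x : ℝ := (#{ω' | E u ((I u).piecewise ω' ω)} : ℝ) with hx
    have hav := havg u hu ω
    have hmain : (Real.exp s - 1) * x ≤ (Real.exp s - 1) * (p * Fintype.card (ι → α)) := by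
      rcases lt_trichotomy s 0 with h | h | h
      · have : Real.exp s - 1 < 0 := by
          have := Real.exp_lt_one_iff.2 h
          linarith
        exact mul_le_mul_of_nonpos_left ((mul_le_mul_left_of_neg h).1 hav) this.le
      · subst h; simp
      · have : 0 < Real.exp s - 1 := by linarith
        exact mul_le_mul_of_nonneg_left (le_of_mul_le_mul_left hav h) this.le
    have hq : 1 + (Real.exp s - 1) * p ≤ Real.exp ((s + s ^ 2) * p) := by
      have := Real.add_one_le_exp ((s + s ^ 2) * p)
      nlinarith
    simp only [sum_const, Finset.card_univ, nsmul_eq_mul, mul_one]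
    calc _ ≤ (Fintype.card (ι → α) : ℝ) + (Real.exp s - 1) * (p * Fintype.card (ι → α)) := by
          linarith
      _ = (1 + (Real.exp s - 1) * p) * Fintype.card (ι → α) := by ring
      _ ≤ _ := mul_le_mul_of_nonneg_right hq hN.le

open scoped Classical in
/-- The symmetric Lovász local lemma for the uniform measure on a finite product. -/
theorem exists_forall_not_of_local_lemma {β : Type*} [Fintype β] [Nonempty α]
    (bad : β → (ι → α) → Prop) (vbl : β → Set ι) {m : ℕ} (hm : 0 < m)
    (hdep : ∀ b, DependsOn (bad b) (vbl b))
    (hdeg : ∀ b, #{b' | ¬ Disjoint (vbl b) (vbl b')} ≤ m)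
    (hprob : ∀ b, 4 * m * #{ω | bad b ω} ≤ Fintype.card (ι → α)) :
    ∃ ω, ∀ b, ¬ bad b ω := by
  set N := Fintype.card (ι → α) with hN
  have hNpos : 0 < N := Fintype.card_pos
  let avoid : Finset β → Finset (ι → α) := fun S => {ω | ∀ b ∈ S, ¬ bad b ω}
  let hit : β → Finset β → Finset (ι → α) := fun a S => {ω | bad a ω ∧ ∀ b ∈ S, ¬ bad b ω}
  have havoid : ∀ S : Finset β, DependsOn (fun ω => ∀ b ∈ S, ¬ bad b ω) (⋃ b ∈ S, vbl b) := by
    intro S x y hxy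
    refine propext (forall₂_congr fun b hb => not_congr (Eq.to_iff (hdep b fun i hi => hxy i ?_)))
    simp only [Set.mem_iUnion]
    exact ⟨b, hb, hi⟩
  have hcover : ∀ S T : Finset β,
      #(avoid T) ≤ #(avoid S) + ∑ b ∈ S \ T, #(hit b T) := by
    intro S T
    refine le_trans (card_le_card (t := avoid S ∪ (S \ T).biUnion fun b => hit b T) ?_)
      ((card_union_le _ _).trans (Nat.add_le_add_left card_biUnion_le _))
    intro ω hω
    simp only [avoid, hit, mem_filter, mem_univ, true_and, mem_union, mem_biUnion,
      mem_sdiff] at hω ⊢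
    by_contra! h
    obtain ⟨⟨b, hb, hbω⟩, h2⟩ := h
    obtain ⟨b', hb', hbω'⟩ := h2 b ⟨hb, fun hbT => hω b hbT hbω⟩ hbω
    exact hω b' hb' hbω'
  have key : ∀ n : ℕ, ∀ S : Finset β, #S = n → 0 < #(avoid S) ∧
      ∀ b, 2 * m * #(hit b S) ≤ #(avoid S) := by
    intro n
    induction n using Nat.strong_induction_on with
    | _ n ih =>
    intro S hS
    have ih' : ∀ T ⊂ S, 0 < #(avoid T) ∧ ∀ b, 2 * m * #(hit b T) ≤ #(avoid T) :=
      fun T hT => ih #T (hS ▸ card_lt_card hT) T rfl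
    have hpos : 0 < #(avoid S) := by
      rcases S.eq_empty_or_nonempty with rfl | ⟨a, ha⟩
      · have : avoid ∅ = univ := by simp [avoid]
        rw [this, Finset.card_univ]
        exact hNpos
      · obtain ⟨h1, h2⟩ := ih' _ (erase_ssubset ha)
        have h3 := hcover S (S.erase a)
        rw [sdiff_erase_self ha, sum_singleton] at h3
        have h4 : 2 * #(hit a (S.erase a)) ≤ #(avoid (S.erase a)) :=
          le_trans (Nat.mul_le_mul_right _ (by omega)) (h2 a)
        omega
    refine ⟨hpos, fun b => ?_⟩
    let T : Finset β := {b' ∈ S | Disjoint (vbl b) (vbl b')}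
    have hTS : T ⊆ S := filter_subset _ _
    have hind : 4 * m * #(hit b T) ≤ #(avoid T) := by
      have h1 : #(hit b T) * N = #{ω | bad b ω} * #(avoid T) := by
        convert card_and_mul_card_of_dependsOn (hdep b) (havoid T) ?_
        simp only [Set.disjoint_iUnion_right]
        exact fun b' hb' => (mem_filter.1 hb').2
      have h2 := Nat.mul_le_mul_right #(avoid T) (hprob b)
      refine Nat.le_of_mul_le_mul_right (c := N) ?_ hNpos
      calc 4 * m * #(hit b T) * N = 4 * m * (#(hit b T) * N) := by ring
        _ = 4 * m * (#{ω | bad b ω} * #(avoid T)) := by rw [h1]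
        _ = 4 * m * #{ω | bad b ω} * #(avoid T) := by ring
        _ ≤ N * #(avoid T) := h2
        _ = _ := mul_comm _ _
    have hle : #(hit b S) ≤ #(hit b T) := by
      refine card_le_card fun ω hω => ?_
      simp only [hit, mem_filter, mem_univ, true_and] at hω ⊢
      exact ⟨hω.1, fun b' hb' => hω.2 b' (hTS hb')⟩
    have hhalf : #(avoid T) ≤ 2 * #(avoid S) := by
      rcases hTS.eq_or_ssubset with hT | hT
      · rw [hT]; omega
      · have h1 := hcover S T
        have h2 : 2 * m * ∑ b' ∈ S \ T, #(hit b' T) ≤ m * #(avoid T) := by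
          rw [mul_sum]
          refine (sum_le_card_nsmul _ _ _ fun b' _ => (ih' T hT).2 b').trans ?_
          rw [smul_eq_mul]
          refine Nat.mul_le_mul_right _ (le_trans (card_le_card fun b' hb' => ?_) (hdeg b))
          simp only [T, mem_sdiff, mem_filter, not_and] at hb'
          simpa using hb'.2 hb'.1
        have h3 : 2 * ∑ b' ∈ S \ T, #(hit b' T) ≤ #(avoid T) := by
          refine Nat.le_of_mul_le_mul_left (c := m) ?_ hm
          linarith
        omega
    have : 4 * m * #(hit b S) ≤ 4 * m * #(hit b T) := Nat.mul_le_mul_left _ hle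
    linarith
  obtain ⟨ω, hω⟩ := card_pos.1 (key _ univ rfl).1
  exact ⟨ω, fun b => (mem_filter.1 hω).2 b (mem_univ _)⟩

end ProductCounting

section Equidistribution

theorem card_filter_coord_mul {ι α : Type*} [Fintype ι] [DecidableEq ι] [Fintype α] (i : ι)
    (A : α → Prop) [DecidablePred A] :
    #{ω : ι → α | A (ω i)} * Fintype.card α = #{a | A a} * Fintype.card (ι → α) := by
  have h : ({ω : ι → α | A (ω i)} : Finset (ι → α))
      = Fintype.piFinset (fun j => if j = i then ({a | A a} : Finset α) else univ) := by
    ext ω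
    simp only [mem_filter, mem_univ, true_and, Fintype.mem_piFinset]
    constructor
    · intro h j
      by_cases hj : j = i
      · subst hj; simpa using h
      · simp [hj]
    · intro h
      simpa using h i
  rw [h, Fintype.card_piFinset, Fintype.card_fun, Fintype.card, ← Finset.card_univ,
    ← Finset.prod_const, ← mul_prod_erase univ _ (mem_univ i),
    ← mul_prod_erase univ (fun _ : ι => #(univ : Finset α)) (mem_univ i)]
  have : ∏ x ∈ univ.erase i, #(if x = i then ({a | A a} : Finset α) else univ)
      = ∏ x ∈ univ.erase i, #(univ : Finset α) :=
    prod_congr rfl fun x hx => by simp [ne_of_mem_erase hx]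
  rw [this]
  simp only [if_true]
  ring

theorem sum_sq_average_shift_le {q : ℕ} [NeZero q] (y : ZMod q → ℝ) (hy : ∑ c, y c = 0) :
    ∑ c, ((y c + y (c - 1)) / 2) ^ 2 ≤ (1 - 1 / (4 * (q : ℝ) ^ 3)) * ∑ c, y c ^ 2 := by
  have hq : (0 : ℝ) < q := by exact_mod_cast Nat.pos_of_ne_zero (NeZero.ne q)
  set S := ∑ c, (y c - y (c - 1)) ^ 2 with hS
  have hS0 : 0 ≤ S := sum_nonneg fun c _ => sq_nonneg _
  have hstep : ∀ c, |y c - y (c - 1)| ≤ √S := fun c => by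
    refine Real.abs_le_sqrt ?_
    exact single_le_sum (f := fun c => (y c - y (c - 1)) ^ 2) (fun c _ => sq_nonneg _) (mem_univ c)
  have hwalk : ∀ (b : ZMod q) (n : ℕ), |y (b + n) - y b| ≤ n * √S := by
    intro b n
    induction n with
    | zero => simp
    | succ n ih =>
      have h1 := hstep (b + (n + 1 : ℕ))
      have h2 : b + ((n + 1 : ℕ) : ZMod q) - 1 = b + n := by push_cast; ring
      rw [h2] at h1
      have h3 := abs_sub_le (y (b + (n + 1 : ℕ))) (y (b + n)) (y b)
      push_cast at h1 h3 ⊢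
      linarith
  have hdist : ∀ b c, |y c - y b| ≤ q * √S := by
    intro b c
    have h1 := hwalk b (c - b).val
    rw [ZMod.natCast_zmod_val, add_sub_cancel] at h1
    refine h1.trans (mul_le_mul_of_nonneg_right ?_ (Real.sqrt_nonneg _))
    exact_mod_cast (ZMod.val_lt _).le
  have hpt : ∀ c, y c ^ 2 ≤ q ^ 2 * S := by
    intro c
    have hb : ∃ b, y c * y b ≤ 0 := by
      by_contra! h
      have h1 : 0 < ∑ b, y c * y b := sum_pos (fun b _ => h b) ⟨c, mem_univ c⟩
      rw [← mul_sum, hy, mul_zero] at h1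
      exact lt_irrefl _ h1
    obtain ⟨b, hb⟩ := hb
    have h1 := hdist b c
    have h2 : (y c - y b) ^ 2 ≤ (q * √S) ^ 2 := sq_le_sq' (by linarith [(abs_le.1 h1).1])
      (abs_le.1 h1).2
    rw [mul_pow, Real.sq_sqrt hS0] at h2
    nlinarith [sq_nonneg (y b)]
  have hsum : ∑ c, y c ^ 2 ≤ q ^ 3 * S := by
    refine (sum_le_sum fun c _ => hpt c).trans ?_
    rw [sum_const, Finset.card_univ, ZMod.card, nsmul_eq_mul]
    exact le_of_eq (by ring)
  have hshift : ∑ c, y (c - 1) ^ 2 = ∑ c, y c ^ 2 :=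
    (Equiv.subRight (1 : ZMod q)).sum_comp (fun c => y c ^ 2)
  have hid : ∑ c, ((y c + y (c - 1)) / 2) ^ 2 = ∑ c, y c ^ 2 - S / 4 := by
    have : ∀ c, ((y c + y (c - 1)) / 2) ^ 2
        = y c ^ 2 / 2 + y (c - 1) ^ 2 / 2 - (y c - y (c - 1)) ^ 2 / 4 := fun c => by ring
    simp only [this, sum_sub_distrib, sum_add_distrib, ← sum_div, hshift, hS]
    ring
  rw [hid]
  have : 1 / (4 * (q : ℝ) ^ 3) * ∑ c, y c ^ 2 ≤ S / 4 := by
    rw [div_mul_eq_mul_div, one_mul, div_le_div_iff₀ (by positivity) (by norm_num)]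
    linarith
  linarith

open scoped Classical in
/-- A sum of many fair bits is nearly equidistributed modulo `q`. -/
theorem card_sum_bits_modEq_le {ι α : Type*} [Fintype ι] [DecidableEq ι] [Fintype α] [Nonempty α]
    {q : ℕ} [NeZero q] (bit : α → ℕ) (hbit : ∀ a, bit a = 0 ∨ bit a = 1)
    (hfair : 2 * #{a | bit a = 0} = Fintype.card α) (J : Finset ι) {ε : ℝ} (hε : 0 ≤ ε)
    (hJ : (1 - 1 / (4 * (q : ℝ) ^ 3)) ^ #J ≤ ε ^ 2) (c : ZMod q) :
    (#{ω : ι → α | ((∑ i ∈ J, bit (ω i) : ℕ) : ZMod q) = c} : ℝ)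
      ≤ (1 / q + ε) * Fintype.card (ι → α) := by
  have hq : (0 : ℝ) < q := by exact_mod_cast Nat.pos_of_ne_zero (NeZero.ne q)
  have hq1 : (1 : ℝ) ≤ q := by exact_mod_cast Nat.pos_of_ne_zero (NeZero.ne q)
  have hN : (0 : ℝ) < Fintype.card (ι → α) := by exact_mod_cast Fintype.card_pos
  have hα : (0 : ℝ) < Fintype.card α := by exact_mod_cast Fintype.card_pos
  set N : ℝ := ((Fintype.card (ι → α) : ℕ) : ℝ) with hNdef
  let p : Finset ι → ZMod q → ℝ := fun J c =>
    (#{ω : ι → α | ((∑ i ∈ J, bit (ω i) : ℕ) : ZMod q) = c} : ℝ) / N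
  have hfair1 : 2 * #{a | bit a = 1} = Fintype.card α := by
    have h1 : #{a | bit a = 0} + #{a | ¬ bit a = 0} = Fintype.card α :=
      card_filter_add_card_filter_not _
    have h2 : #{a | ¬ bit a = 0} = #{a | bit a = 1} := by
      congr 1; ext a
      have := hbit a
      simp only [mem_filter, mem_univ, true_and]
      omega
    omega
  have hcoord : ∀ (i : ι) (b : ℕ), 2 * #{a | bit a = b} = Fintype.card α →
      (#{ω : ι → α | bit (ω i) = b} : ℝ) = N / 2 := by
    intro i b hb
    have h1 := card_filter_coord_mul (ι := ι) i (fun a => bit a = b)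
    have h1' : (#{ω : ι → α | bit (ω i) = b} : ℝ) * Fintype.card α = #{a | bit a = b} * N := by
      rw [hNdef]; exact_mod_cast h1
    have h2 : (2 : ℝ) * #{a | bit a = b} = Fintype.card α := by exact_mod_cast hb
    rw [← h2] at h1' hα
    have h3 : (0 : ℝ) < #{a | bit a = b} := by linarith
    field_simp
    nlinarith
  have hrec : ∀ J i, i ∉ J → ∀ c, p (insert i J) c = (p J c + p J (c - 1)) / 2 := by
    intro J i hi c
    have hdepJ : ∀ c' : ZMod q, DependsOn
        (fun ω : ι → α => ((∑ i ∈ J, bit (ω i) : ℕ) : ZMod q) = c') (J : Set ι) := by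
      intro c' x y hxy
      have : ∑ i ∈ J, bit (x i) = ∑ i ∈ J, bit (y i) :=
        sum_congr rfl fun i hi => by rw [hxy i (by simpa using hi)]
      simp only [this]
    have hdepi : ∀ b : ℕ, DependsOn (fun ω : ι → α => bit (ω i) = b) ({i} : Set ι) := by
      intro b x y hxy
      have := hxy i rfl
      simp only [this]
    have hprod : ∀ (b : ℕ) (c' : ZMod q), 2 * #{a | bit a = b} = Fintype.card α →
        (#{ω : ι → α | bit (ω i) = b ∧ ((∑ i ∈ J, bit (ω i) : ℕ) : ZMod q) = c'} : ℝ)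
          = N * p J c' / 2 := by
      intro b c' hb
      have h1 := card_and_mul_card_of_dependsOn (hdepi b) (hdepJ c')
        (by simpa using hi)
      have h2 : (#{ω : ι → α | bit (ω i) = b ∧ ((∑ i ∈ J, bit (ω i) : ℕ) : ZMod q) = c'} : ℝ) * N
          = #{ω : ι → α | bit (ω i) = b}
            * #{ω : ι → α | ((∑ i ∈ J, bit (ω i) : ℕ) : ZMod q) = c'} := by
        rw [hNdef]; exact_mod_cast h1
      rw [hcoord i b hb] at h2
      simp only [p]
      field_simp
      nlinarith
    have hsplit : (#{ω : ι → α | ((∑ i ∈ insert i J, bit (ω i) : ℕ) : ZMod q) = c} : ℝ)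
        = #{ω : ι → α | bit (ω i) = 0 ∧ ((∑ i ∈ J, bit (ω i) : ℕ) : ZMod q) = c}
        + #{ω : ι → α | bit (ω i) = 1 ∧ ((∑ i ∈ J, bit (ω i) : ℕ) : ZMod q) = c - 1} := by
      rw [← Nat.cast_add, ← card_union_of_disjoint]
      · congr 2
        ext ω
        simp only [mem_filter, mem_univ, true_and, mem_union, sum_insert hi]
        rcases hbit (ω i) with h | h
        · simp [h]
        · simp [h, eq_sub_iff_add_eq, add_comm]
      · rw [disjoint_left]
        intro ω h1 h2
        simp only [mem_filter, mem_univ, true_and] at h1 h2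
        omega
    have : p (insert i J) c
        = (#{ω : ι → α | ((∑ i ∈ insert i J, bit (ω i) : ℕ) : ZMod q) = c} : ℝ) / N := rfl
    rw [this, hsplit, hprod 0 c hfair, hprod 1 (c - 1) hfair1]
    field_simp
  have hsum1 : ∀ J, ∑ c, p J c = 1 := by
    intro J
    simp only [p]
    rw [← sum_div, ← Nat.cast_sum, ← card_eq_sum_card_fiberwise (fun _ _ => mem_univ _),
      Finset.card_univ, div_self hN.ne']
  have hE : ∀ J, ∑ c, (p J c - 1 / q) ^ 2 ≤ (1 - 1 / (4 * (q : ℝ) ^ 3)) ^ #J := by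
    intro J
    induction J using Finset.induction_on with
    | empty =>
      simp only [p, sum_empty, Nat.cast_zero, card_empty, pow_zero]
      have h1 : ∀ c : ZMod q, ((#{ω : ι → α | (0 : ZMod q) = c} : ℝ) / N)
          = if c = 0 then 1 else 0 := by
        intro c
        by_cases hc : c = 0
        · subst hc; simp only [filter_true, Finset.card_univ, if_true]; exact div_self hN.ne'
        · simp [hc, Ne.symm hc]
      simp only [h1]
      rw [← add_sum_erase univ _ (mem_univ 0)]
      have h2 : ∑ x ∈ univ.erase (0 : ZMod q), ((if x = 0 then (1 : ℝ) else 0) - 1 / q) ^ 2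
          = ((q : ℝ) - 1) * (1 / q) ^ 2 := by
        rw [sum_congr rfl (g := fun _ => (1 / (q : ℝ)) ^ 2)
          (fun x hx => by rw [if_neg (ne_of_mem_erase hx)]; ring)]
        rw [sum_const, card_erase_of_mem (mem_univ _), Finset.card_univ, ZMod.card, nsmul_eq_mul,
          Nat.cast_pred (Nat.pos_of_ne_zero (NeZero.ne q))]
      rw [h2]
      simp only [if_true]
      have : (1 - 1 / (q : ℝ)) ^ 2 + ((q : ℝ) - 1) * (1 / q) ^ 2 = 1 - 1 / q := by field_simp; ring
      rw [this]
      have : 0 < 1 / (q : ℝ) := by positivity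
      linarith
    | insert i J hi ih =>
      have h := sum_sq_average_shift_le (fun c => p J c - 1 / q) (by
        rw [sum_sub_distrib, hsum1, sum_const, Finset.card_univ, ZMod.card, nsmul_eq_mul]
        field_simp; simp)
      rw [card_insert_of_notMem hi, pow_succ']
      have h0 : 0 ≤ 1 - 1 / (4 * (q : ℝ) ^ 3) := by
        rw [sub_nonneg, div_le_one (by positivity)]
        nlinarith [pow_le_pow_left₀ zero_le_one hq1 3]
      refine le_trans (le_of_eq ?_) (h.trans (mul_le_mul_of_nonneg_left ih h0))
      refine sum_congr rfl fun c _ => ?_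
      rw [hrec J i hi c]
      ring
  have h1 : (p J c - 1 / q) ^ 2 ≤ ε ^ 2 :=
    (single_le_sum (f := fun c => (p J c - 1 / (q : ℝ)) ^ 2) (fun c _ => sq_nonneg _)
      (mem_univ c)).trans ((hE J).trans hJ)
  have h2 := abs_le_of_sq_le_sq' h1 hε
  have h3 : p J c ≤ 1 / q + ε := by linarith [h2.2]
  exact (div_le_iff₀ hN).1 h3

end Equidistribution

section Digits

open scoped Classical in
theorem card_digits_modEq_le {ι : Type*} [Fintype ι] [DecidableEq ι] {P X q : ℕ} [NeZero P]
    [NeZero X] [NeZero q] {i₂ i₀ : ι} {J : Finset ι} (h20 : i₂ ≠ i₀) (h2J : i₂ ∉ J)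
    (h0J : i₀ ∉ J) {ε : ℝ} (hε : 0 ≤ ε)
    (hJ : (1 - 1 / (4 * (q : ℝ) ^ 3)) ^ #J ≤ ε ^ 2) (C a : ℕ) :
    (#{ω : ι → Fin P × Fin X × Fin 2 | C + ((ω i₂).1 + P * (ω i₀).2.1
        + P * X * ∑ i ∈ J, ((ω i).2.2 : ℕ)) ≡ a [MOD P * X * q]} : ℝ)
      ≤ (1 / q + ε) / (P * X) * Fintype.card (ι → Fin P × Fin X × Fin 2) := by
  have hP : 0 < P := Nat.pos_of_ne_zero (NeZero.ne P)
  have hX : 0 < X := Nat.pos_of_ne_zero (NeZero.ne X)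
  have hq : 0 < q := Nat.pos_of_ne_zero (NeZero.ne q)
  set N := Fintype.card (ι → Fin P × Fin X × Fin 2) with hN
  have hNpos : 0 < N := Fintype.card_pos
  rcases Finset.eq_empty_or_nonempty ({ω : ι → Fin P × Fin X × Fin 2 | C + ((ω i₂).1
    + P * (ω i₀).2.1 + P * X * ∑ i ∈ J, ((ω i).2.2 : ℕ)) ≡ a [MOD P * X * q]} :
      Finset (ι → Fin P × Fin X × Fin 2)) with h | ⟨ξ, hξ⟩
  · rw [h]
    simp only [card_empty, Nat.cast_zero]
    positivity
  simp only [mem_filter, mem_univ, true_and] at hξ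
  set t := (ξ i₂).1
  set y := (ξ i₀).2.1
  set c : ZMod q := ((∑ i ∈ J, ((ξ i).2.2 : ℕ) : ℕ) : ZMod q)
  let A : (ι → Fin P × Fin X × Fin 2) → Prop := fun ω => (ω i₂).1 = t
  let B : (ι → Fin P × Fin X × Fin 2) → Prop := fun ω => (ω i₀).2.1 = y
  let D : (ι → Fin P × Fin X × Fin 2) → Prop :=
    fun ω => ((∑ i ∈ J, ((ω i).2.2 : ℕ) : ℕ) : ZMod q) = c
  have hsub : #{ω : ι → Fin P × Fin X × Fin 2 | C + ((ω i₂).1 + P * (ω i₀).2.1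
        + P * X * ∑ i ∈ J, ((ω i).2.2 : ℕ)) ≡ a [MOD P * X * q]}
      ≤ #{ω | (A ω ∧ B ω) ∧ D ω} := by
    refine card_le_card fun ω hω => ?_
    simp only [mem_filter, mem_univ, true_and, A, B, D] at hω ⊢
    have h1 := Nat.ModEq.add_left_cancel' C (hω.trans hξ.symm)
    rw [mul_assoc, mul_assoc, mul_assoc P X, add_assoc, add_assoc, ← mul_add, ← mul_add] at h1
    have h2 : ((ω i₂).1 : ℕ) = t := by
      have := h1.of_mul_right (X * q)
      rw [Nat.ModEq, Nat.add_mul_mod_self_left, Nat.add_mul_mod_self_left] at this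
      rwa [Nat.mod_eq_of_lt (ω i₂).1.2, Nat.mod_eq_of_lt t.2] at this
    rw [h2] at h1
    have h3 := (Nat.ModEq.add_left_cancel' _ h1).mul_left_cancel' hP.ne'
    have h4 : ((ω i₀).2.1 : ℕ) = y := by
      have := h3.of_mul_right q
      rw [Nat.ModEq, Nat.add_mul_mod_self_left, Nat.add_mul_mod_self_left] at this
      rwa [Nat.mod_eq_of_lt (ω i₀).2.1.2, Nat.mod_eq_of_lt y.2] at this
    rw [h4] at h3
    have h5 := (Nat.ModEq.add_left_cancel' _ h3).mul_left_cancel' hX.ne'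
    exact ⟨⟨Fin.ext h2, Fin.ext h4⟩, (ZMod.natCast_eq_natCast_iff _ _ _).2 h5⟩
  have hA : (#{ω | A ω} : ℝ) = N / P := by
    have h := card_filter_coord_mul (ι := ι) i₂ (fun a : Fin P × Fin X × Fin 2 => a.1 = t)
    have h' : #{a : Fin P × Fin X × Fin 2 | a.1 = t} = X * 2 := by
      have : ({a : Fin P × Fin X × Fin 2 | a.1 = t} : Finset _) = {t} ×ˢ univ := by
        ext
        simp only [mem_filter, mem_univ, true_and, mem_product, mem_singleton, and_true]
      rw [this]; simp
    rw [h'] at h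
    simp only [Fintype.card_prod, Fintype.card_fin] at h
    rw [eq_div_iff (by positivity)]
    have h2 : #{ω | A ω} * P = N := by
      refine Nat.eq_of_mul_eq_mul_right (show 0 < X * 2 by positivity) ?_
      rw [mul_assoc, mul_comm N]
      convert h using 1
    exact_mod_cast h2
  have hB : (#{ω | B ω} : ℝ) = N / X := by
    have h := card_filter_coord_mul (ι := ι) i₀ (fun a : Fin P × Fin X × Fin 2 => a.2.1 = y)
    have h' : #{a : Fin P × Fin X × Fin 2 | a.2.1 = y} = P * 2 := by
      have : ({a : Fin P × Fin X × Fin 2 | a.2.1 = y} : Finset _) = univ ×ˢ {y} ×ˢ univ := by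
        ext
        simp only [mem_filter, mem_univ, true_and, mem_product, mem_singleton, and_true]
      rw [this]; simp
    rw [h'] at h
    simp only [Fintype.card_prod, Fintype.card_fin] at h
    rw [eq_div_iff (by positivity)]
    have h2 : #{ω | B ω} * X = N := by
      refine Nat.eq_of_mul_eq_mul_right (show 0 < P * 2 by positivity) ?_
      have h3 : #{ω | B ω} * (P * (X * 2)) = P * 2 * N := by convert h using 1
      linarith
    exact_mod_cast h2
  have hD : (#{ω | D ω} : ℝ) ≤ (1 / q + ε) * N := by
    refine card_sum_bits_modEq_le (fun a : Fin P × Fin X × Fin 2 => (a.2.2 : ℕ))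
      (fun a => by have := a.2.2.2; omega) ?_ J hε hJ c
    have : ({a : Fin P × Fin X × Fin 2 | (a.2.2 : ℕ) = 0} : Finset _)
        = univ ×ˢ univ ×ˢ {0} := by
      ext ⟨x, y, z⟩
      simp only [mem_filter, mem_univ, true_and, mem_product, mem_singleton, Fin.ext_iff,
        Fin.val_zero]
    rw [this]; simp; ring
  have hdA : DependsOn A ({i₂} : Set ι) := fun x y h => by simp only [A, h i₂ rfl]
  have hdB : DependsOn B ({i₀} : Set ι) := fun x y h => by simp only [B, h i₀ rfl]
  have hdD : DependsOn D (J : Set ι) := fun x y h => by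
    have : ∑ i ∈ J, ((x i).2.2 : ℕ) = ∑ i ∈ J, ((y i).2.2 : ℕ) :=
      sum_congr rfl fun i hi => by rw [h i (by simpa using hi)]
    simp only [D, this]
  have hdAB : DependsOn (fun ω => A ω ∧ B ω) ({i₂, i₀} : Set ι) := fun x y h => by
    simp only [hdA (x := x) (y := y) (fun i hi => h i (by simp_all)),
      hdB (x := x) (y := y) (fun i hi => h i (by simp_all))]
  have e1 := card_and_mul_card_of_dependsOn hdA hdB (by simpa using h20)
  have e2 := card_and_mul_card_of_dependsOn hdAB hdD (by
    rw [Set.disjoint_left]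
    rintro i (rfl | rfl)
    · simpa using h2J
    · simpa using h0J)
  have e1' : (#{ω | A ω ∧ B ω} : ℝ) * N = #{ω | A ω} * #{ω | B ω} := by
    rw [hN]; exact_mod_cast e1
  have e2' : (#{ω | (A ω ∧ B ω) ∧ D ω} : ℝ) * N = #{ω | A ω ∧ B ω} * #{ω | D ω} := by
    rw [hN]; exact_mod_cast e2
  have hN' : (0 : ℝ) < N := by exact_mod_cast hNpos
  have hP' : (0 : ℝ) < P := by exact_mod_cast hP
  have hX' : (0 : ℝ) < X := by exact_mod_cast hX
  have hAB : (#{ω | A ω ∧ B ω} : ℝ) = N / (P * X) := by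
    rw [hA, hB] at e1'
    field_simp at e1' ⊢
    linarith
  rw [hAB] at e2'
  have : (#{ω | (A ω ∧ B ω) ∧ D ω} : ℝ) = #{ω | D ω} / (P * X) := by
    field_simp at e2' ⊢
    linarith
  calc _ ≤ (#{ω | (A ω ∧ B ω) ∧ D ω} : ℝ) := by exact_mod_cast hsub
    _ = #{ω | D ω} / (P * X) := this
    _ ≤ ((1 / q + ε) * N) / (P * X) := by gcongr
    _ = _ := by ring

end Digits

section Graph

variable {V : Type*} [Fintype V] [DecidableEq V]

theorem exists_properEdgeColoring_lt (G : SimpleGraph V) [DecidableRel G.Adj] :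
    ∃ π : Sym2 V → ℕ, (∀ e ∈ G.edgeSet, π e < 2 * G.maxDegree) ∧
      ∀ e₁ ∈ G.edgeSet, ∀ e₂ ∈ G.edgeSet, e₁ ≠ e₂ → (∃ v, v ∈ e₁ ∧ v ∈ e₂) → π e₁ ≠ π e₂ := by
  suffices h : ∀ S : Finset (Sym2 V), S ⊆ G.edgeFinset → ∃ π : Sym2 V → ℕ,
      (∀ e ∈ S, π e < 2 * G.maxDegree) ∧
      ∀ e₁ ∈ S, ∀ e₂ ∈ S, e₁ ≠ e₂ → (∃ v, v ∈ e₁ ∧ v ∈ e₂) → π e₁ ≠ π e₂ by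
    obtain ⟨π, h1, h2⟩ := h G.edgeFinset subset_rfl
    refine ⟨π, fun e he => h1 e (by simpa using he), fun e he e' he' => h2 e (by simpa using he) e'
      (by simpa using he')⟩
  intro S
  induction S using Finset.induction_on with
  | empty => exact fun _ => ⟨fun _ => 0, by simp⟩
  | insert e S he ih =>
    intro hS
    obtain ⟨π, h1, h2⟩ := ih ((subset_insert _ _).trans hS)
    have heG : e ∈ G.edgeSet := by simpa using hS (mem_insert_self e S)
    obtain ⟨c, hc, hcπ⟩ : ∃ c ∈ range (2 * G.maxDegree),
        c ∉ (S.filter fun e' => ∃ v, v ∈ e ∧ v ∈ e').image π := by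
      by_contra! h
      have hle := (card_le_card (show range (2 * G.maxDegree) ⊆ _ from h)).trans card_image_le
      rw [card_range] at hle
      induction e using Sym2.ind with
      | _ u v =>
      have hsub : (S.filter fun e' => ∃ w, w ∈ s(u, v) ∧ w ∈ e')
          ⊆ (G.incidenceFinset u).erase s(u, v) ∪ (G.incidenceFinset v).erase s(u, v) := by
        intro e' he'
        obtain ⟨h3, w, hw, hw'⟩ := mem_filter.1 he'
        have h4 : e' ∈ G.edgeSet := by simpa using hS (mem_insert_of_mem h3)
        have h5 : e' ≠ s(u, v) := fun h => he (h ▸ h3)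
        simp only [mem_union, mem_erase, SimpleGraph.mem_incidenceFinset]
        rcases Sym2.mem_iff.1 hw with rfl | rfl
        · exact Or.inl ⟨h5, h4, hw'⟩
        · exact Or.inr ⟨h5, h4, hw'⟩
      have hu : #((G.incidenceFinset u).erase s(u, v)) + 1 ≤ G.maxDegree := by
        rw [card_erase_add_one (by simpa using heG),
          SimpleGraph.card_incidenceFinset_eq_degree]
        exact G.degree_le_maxDegree u
      have hv : #((G.incidenceFinset v).erase s(u, v)) + 1 ≤ G.maxDegree := by
        rw [card_erase_add_one (by simpa [SimpleGraph.incidenceSet] using heG),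
          SimpleGraph.card_incidenceFinset_eq_degree]
        exact G.degree_le_maxDegree v
      have := (card_le_card hsub).trans (card_union_le _ _)
      omega
    have hne : ∀ e' ∈ S, e' ≠ e := fun e' h h' => he (h' ▸ h)
    refine ⟨Function.update π e c, ?_, ?_⟩
    · intro e' he'
      rcases mem_insert.1 he' with rfl | h
      · simpa using hc
      · rw [Function.update_of_ne (hne e' h)]
        exact h1 e' h
    · intro e₁ he₁ e₂ he₂ h12 hv
      rcases mem_insert.1 he₁ with rfl | h₁ <;> rcases mem_insert.1 he₂ with rfl | h₂
      · exact absurd rfl h12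
      · rw [Function.update_self, Function.update_of_ne (hne e₂ h₂)]
        exact fun h => hcπ (mem_image.2 ⟨e₂, mem_filter.2 ⟨h₂, hv⟩, h.symm⟩)
      · rw [Function.update_self, Function.update_of_ne (hne e₁ h₁)]
        exact fun h => hcπ (mem_image.2 ⟨e₁, mem_filter.2 ⟨h₁, hv.imp fun v h => h.symm⟩, h⟩)
      · rw [Function.update_of_ne (hne e₁ h₁), Function.update_of_ne (hne e₂ h₂)]
        exact h2 e₁ h₁ e₂ h₂ h12 hv

open scoped Classical in
theorem card_filter_edist_le (G : SimpleGraph V) [DecidableRel G.Adj] (n : ℕ) (v : V) :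
    #{w | G.edist v w ≤ n} ≤ (G.maxDegree + 1) ^ n := by
  induction n generalizing v with
  | zero => simp [card_le_one]
  | succ n ih =>
    have hsub : ({w | G.edist v w ≤ (n + 1 : ℕ)} : Finset V)
        ⊆ (insert v (G.neighborFinset v)).biUnion fun x => {w | G.edist x w ≤ n} := by
      intro w hw
      simp only [mem_filter, mem_univ, true_and, mem_biUnion, mem_insert,
        SimpleGraph.mem_neighborFinset] at hw ⊢
      obtain ⟨p, hp⟩ := SimpleGraph.exists_walk_of_edist_ne_top
        (ne_top_of_le_ne_top (ENat.natCast_ne_top _) hw)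
      cases p with
      | nil => exact ⟨v, Or.inl rfl, by simp⟩
      | @cons _ x _ hx p =>
        refine ⟨x, Or.inr hx, (SimpleGraph.edist_le p).trans ?_⟩
        rw [← hp] at hw
        rw [SimpleGraph.Walk.length_cons] at hw
        have : p.length + 1 ≤ n + 1 := by exact_mod_cast hw
        exact_mod_cast (by omega : p.length ≤ n)
    refine (card_le_card hsub).trans (card_biUnion_le.trans ?_)
    refine (sum_le_card_nsmul _ _ _ fun x _ => ih x).trans ?_
    rw [smul_eq_mul, pow_succ']
    refine Nat.mul_le_mul_right _ ((card_insert_le _ _).trans ?_)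
    exact Nat.succ_le_succ (G.degree_le_maxDegree v)

open scoped Classical in
theorem card_filter_ne_and_edist_le (G : SimpleGraph V) [DecidableRel G.Adj] (n : ℕ) (v : V) :
    #{w | w ≠ v ∧ G.edist v w ≤ (n + 1 : ℕ)} ≤ G.degree v * (G.maxDegree + 1) ^ n := by
  have hsub : ({w | w ≠ v ∧ G.edist v w ≤ (n + 1 : ℕ)} : Finset V)
      ⊆ (G.neighborFinset v).biUnion fun x => {w | G.edist x w ≤ n} := by
    intro w hw
    simp only [mem_filter, mem_univ, true_and, mem_biUnion,
      SimpleGraph.mem_neighborFinset] at hw ⊢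
    obtain ⟨hwv, hw⟩ := hw
    obtain ⟨p, hp⟩ := SimpleGraph.exists_walk_of_edist_ne_top
      (ne_top_of_le_ne_top (ENat.natCast_ne_top _) hw)
    cases p with
    | nil => exact absurd rfl hwv
    | @cons _ x _ hx p =>
      refine ⟨x, hx, (SimpleGraph.edist_le p).trans ?_⟩
      rw [← hp] at hw
      rw [SimpleGraph.Walk.length_cons] at hw
      have : p.length + 1 ≤ n + 1 := by exact_mod_cast hw
      exact_mod_cast (by omega : p.length ≤ n)
  refine (card_le_card hsub).trans (card_biUnion_le.trans ?_)
  exact sum_le_card_nsmul _ _ _ fun x _ => card_filter_edist_le G n x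

end Graph

section Coarse

open scoped Classical in
/-- Starting from the constant weight `1`, weights in `{0, 1, 2}` can be chosen so that
conflicting vertices get different weighted degrees, provided that every vertex owns twice as many
incident edges as it has earlier conflicts. -/
theorem exists_weight_ne_of_two_mul_card_le {V : Type*} [Fintype V] [DecidableEq V]
    (G : SimpleGraph V) [DecidableRel G.Adj] {ρ : V → ℕ} (hρ : Function.Injective ρ) (m : V → ℕ)
    (H : V → V → Prop) (O : V → Finset V) (hO : ∀ v, O v ⊆ G.neighborFinset v)
    (hO' : ∀ v w, w ∈ O v → v ∉ O w) (hcard : ∀ v, 2 * #{u | ρ u < ρ v ∧ H u v} ≤ #(O v)) :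
    ∃ b : Sym2 V → ℕ, (∀ e, b e ≤ 2) ∧ ∀ u v, ρ u < ρ v → H u v →
      m u + ∑ w ∈ G.neighborFinset u, b s(u, w) ≠ m v + ∑ w ∈ G.neighborFinset v, b s(v, w) := by
  suffices h : ∀ n, ∃ b : Sym2 V → ℕ, (∀ e, b e ≤ 2) ∧
      (∀ v w, n ≤ ρ v → w ∈ O v → b s(v, w) = 1) ∧
      ∀ u v, ρ u < ρ v → ρ v < n → H u v → (m u + ∑ w ∈ G.neighborFinset u, b s(u, w)) / 2
        ≠ (m v + ∑ w ∈ G.neighborFinset v, b s(v, w)) / 2 by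
    obtain ⟨b, h1, -, h3⟩ := h (univ.sup ρ + 1)
    exact ⟨b, h1, fun u v huv hH h => h3 u v huv
      (Nat.lt_succ_of_le (le_sup (mem_univ v))) hH (by rw [h])⟩
  intro n
  induction n with
  | zero => exact ⟨fun _ => 1, by simp⟩
  | succ n ih =>
  obtain ⟨b, h1, h2, h3⟩ := ih
  by_cases hv : ∃ v, ρ v = n
  swap
  · refine ⟨b, h1, fun v w h => h2 v w (by omega), fun u v huv hvn => h3 u v huv ?_⟩
    have : ρ v ≠ n := fun h => hv ⟨v, h⟩
    omega
  obtain ⟨v, rfl⟩ := hv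
  let S : V → ℕ := fun u => m u + ∑ w ∈ G.neighborFinset u, b s(u, w)
  let dn : Finset V := {w ∈ O v | ρ w < ρ v ∧ S w % 2 = 1}
  let up : Finset V := {w ∈ O v | ¬ (ρ w < ρ v ∧ S w % 2 = 1)}
  have hdnup : #dn + #up = #(O v) := card_filter_add_card_filter_not _
  let b' : Finset V → Finset V → Sym2 V → ℕ := fun A B e =>
    if e ∈ A.image (fun w => s(v, w)) then 0 else if e ∈ B.image (fun w => s(v, w)) then 2 else b e
  have hvO : ∀ w ∈ O v, w ≠ v := fun w hw h => by
    have := hO v hw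
    rw [h] at this
    simp at this
  have hmem : ∀ (A : Finset V) (w : V), s(v, w) ∈ A.image (fun w => s(v, w)) ↔ w ∈ A := by
    intro A w
    simp only [mem_image, Sym2.congr_right, exists_eq_right]
  have hmem' : ∀ (A : Finset V), A ⊆ O v → ∀ u w, u ≠ v →
      (s(u, w) ∈ A.image (fun w => s(v, w)) ↔ w = v ∧ u ∈ A) := by
    intro A hA u w hu
    simp only [mem_image]
    constructor
    · rintro ⟨x, hx, h⟩
      rcases Sym2.eq_iff.1 h with ⟨rfl, -⟩ | ⟨rfl, rfl⟩
      · exact absurd rfl hu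
      · exact ⟨rfl, hx⟩
    · rintro ⟨rfl, h⟩
      exact ⟨u, h, Sym2.eq_swap⟩
  have hself : ∀ A ⊆ dn, ∀ B ⊆ up,
      (m v + ∑ w ∈ G.neighborFinset v, b' A B s(v, w)) + #A = S v + #B := by
    intro A hA B hB
    have hAO : A ⊆ O v := hA.trans (filter_subset _ _)
    have hBO : B ⊆ O v := hB.trans (filter_subset _ _)
    have hAB : ∀ w ∈ A, w ∉ B := fun w hw hw' =>
      (mem_filter.1 (hB hw')).2 (mem_filter.1 (hA hw)).2
    have : ∀ w, b' A B s(v, w) + (if w ∈ A then 1 else 0) = b s(v, w) + if w ∈ B then 1 else 0 := by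
      intro w
      simp only [b', hmem]
      by_cases hwA : w ∈ A
      · simp [hwA, hAB w hwA, h2 v w le_rfl (hAO hwA)]
      · by_cases hwB : w ∈ B
        · simp [hwA, hwB, h2 v w le_rfl (hBO hwB)]
        · simp [hwA, hwB]
    have h := sum_congr (s₁ := G.neighborFinset v) rfl fun w _ => this w
    rw [sum_add_distrib, sum_add_distrib, sum_ite_mem, sum_ite_mem,
      inter_eq_right.2 (hAO.trans (hO v)), inter_eq_right.2 (hBO.trans (hO v))] at h
    simp only [sum_const, smul_eq_mul, mul_one] at h
    simp only [S]
    omega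
  have hother : ∀ A ⊆ dn, ∀ B ⊆ up, ∀ u, ρ u < ρ v →
      (m u + ∑ w ∈ G.neighborFinset u, b' A B s(u, w)) / 2 = S u / 2 := by
    intro A hA B hB u hu
    have hAO : A ⊆ O v := hA.trans (filter_subset _ _)
    have hBO : B ⊆ O v := hB.trans (filter_subset _ _)
    have huv : u ≠ v := fun h => by simp [h] at hu
    have hval : ∀ w, b' A B s(u, w) + (if w = v then if u ∈ A then 1 else 0 else 0)
        = b s(u, w) + if w = v then if u ∈ B then 1 else 0 else 0 := by
      intro w
      simp only [b', hmem' A hAO u w huv, hmem' B hBO u w huv]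
      by_cases hw : w = v
      · subst hw
        by_cases huA : u ∈ A
        · have huB : u ∉ B := fun hw' => (mem_filter.1 (hB hw')).2 (mem_filter.1 (hA huA)).2
          have := h2 w u le_rfl (hAO huA)
          rw [Sym2.eq_swap] at this
          simp [huA, huB, this]
        · by_cases huB : u ∈ B
          · have := h2 w u le_rfl (hBO huB)
            rw [Sym2.eq_swap] at this
            simp [huA, huB, this]
          · simp [huA, huB]
      · simp [hw]
    have h := sum_congr (s₁ := G.neighborFinset u) rfl fun w _ => hval w
    rw [sum_add_distrib, sum_add_distrib, sum_ite_eq', sum_ite_eq'] at h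
    by_cases huA : u ∈ A
    · have huB : u ∉ B := fun hw' => (mem_filter.1 (hB hw')).2 (mem_filter.1 (hA huA)).2
      have hadj := hO v (hAO huA)
      rw [SimpleGraph.mem_neighborFinset] at hadj
      have hodd := (mem_filter.1 (hA huA)).2.2
      simp only [SimpleGraph.mem_neighborFinset, hadj.symm, huA, huB, if_true, if_false] at h
      simp only [S] at hodd ⊢
      omega
    · by_cases huB : u ∈ B
      · have hadj := hO v (hBO huB)
        rw [SimpleGraph.mem_neighborFinset] at hadj
        have hev : ¬ S u % 2 = 1 := fun h => (mem_filter.1 (hB huB)).2 ⟨hu, h⟩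
        simp only [SimpleGraph.mem_neighborFinset, hadj.symm, huA, huB, if_true, if_false] at h
        simp only [S] at hev ⊢
        omega
      · simp only [huA, huB, if_false, ite_self, add_zero] at h
        simp only [S, h]
  have hreach : ∀ t ≤ #(O v), ∃ A ⊆ dn, ∃ B ⊆ up,
      (m v + ∑ w ∈ G.neighborFinset v, b' A B s(v, w)) + #dn = S v + t := by
    intro t ht
    rcases le_total t #dn with h | h
    · obtain ⟨A, hA, hAc⟩ := exists_subset_card_eq (Nat.sub_le #dn t)
      refine ⟨A, hA, ∅, empty_subset _, ?_⟩
      have := hself A hA ∅ (empty_subset _)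
      rw [card_empty] at this
      omega
    · obtain ⟨B, hB, hBc⟩ := exists_subset_card_eq (s := up) (n := t - #dn) (by omega)
      refine ⟨∅, empty_subset _, B, hB, ?_⟩
      have := hself ∅ (empty_subset _) B hB
      rw [card_empty] at this
      omega
  let C : Finset V := {u | ρ u < ρ v ∧ H u v}
  have hC : 2 * #C ≤ #(O v) := hcard v
  have hdnS : #dn ≤ S v := by
    have := hself dn subset_rfl ∅ (empty_subset _)
    rw [card_empty] at this
    omega
  obtain ⟨x, hx, hxC⟩ : ∃ x ∈ (range (#C + 1)).image (fun i => (S v - #dn) / 2 + i),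
      x ∉ C.image (fun u => S u / 2) := by
    by_contra! h
    have := (card_le_card (show (range (#C + 1)).image (fun i => (S v - #dn) / 2 + i) ⊆ _
      from h)).trans card_image_le
    rw [card_image_of_injective _ (add_right_injective _), card_range] at this
    omega
  obtain ⟨i, hi, rfl⟩ := mem_image.1 hx
  rw [mem_range] at hi
  obtain ⟨A, hA, B, hB, hAB⟩ := hreach (2 * i) (by omega)
  refine ⟨b' A B, ?_, ?_, ?_⟩
  · intro e
    simp only [b']
    split_ifs
    · omega
    · omega
    · exact h1 e
  · intro u w hu hw
    have huv : u ≠ v := fun h => by simp [h] at hu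
    have hAO : A ⊆ O v := hA.trans (filter_subset _ _)
    have hBO : B ⊆ O v := hB.trans (filter_subset _ _)
    simp only [b', hmem' A hAO u w huv, hmem' B hBO u w huv]
    rw [if_neg, if_neg]
    · exact h2 u w (by omega) hw
    · rintro ⟨rfl, h⟩
      exact hO' _ _ hw (hBO h)
    · rintro ⟨rfl, h⟩
      exact hO' _ _ hw (hAO h)
  · intro u w huw hw hH
    rcases Nat.lt_or_ge (ρ w) (ρ v) with h | h
    · rw [hother A hA B hB u (huw.trans h), hother A hA B hB w h]
      exact h3 u w huw h hH
    · obtain rfl : w = v := hρ (by omega)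
      rw [hother A hA B hB u huw]
      intro heq
      refine hxC (mem_image.2 ⟨u, mem_filter.2 ⟨mem_univ _, huw, hH⟩, ?_⟩)
      simp only [heq]
      omega

end Coarse

section Tails

variable {ι α κ : Type*} [Fintype ι] [DecidableEq ι] [Fintype α]

open scoped Classical in
theorem card_upper_tail_le [Nonempty α] (U : Finset κ) (I : κ → Finset ι)
    {E : κ → (ι → α) → Prop} {η p μ : ℝ} (hη : 0 ≤ η) (hη2 : η ≤ 2) (hp : 0 ≤ p)
    (hμ : p * #U ≤ μ)
    (hdep : ∀ u ∈ U, ∀ u' ∈ U, u ≠ u' → ∀ ω ω', E u' ((I u).piecewise ω' ω) ↔ E u' ω)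
    (havg : ∀ u ∈ U, ∀ ω, #{ω' | E u ((I u).piecewise ω' ω)} ≤ p * Fintype.card (ι → α)) :
    (#{ω | (1 + η) * μ < #{u ∈ U | E u ω}} : ℝ)
      ≤ Real.exp (-(η ^ 2 * μ / 4)) * Fintype.card (ι → α) := by
  have h := sum_exp_card_le U I (s := η / 2) (by rw [abs_of_nonneg (by linarith)]; linarith) hp hdep
    (fun u hu ω => mul_le_mul_of_nonneg_left (havg u hu ω) (by linarith))
  have h1 : (#{ω | (1 + η) * μ < #{u ∈ U | E u ω}} : ℝ) * Real.exp (η / 2 * ((1 + η) * μ))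
      ≤ ∑ ω, Real.exp (η / 2 * #{u ∈ U | E u ω}) := by
    rw [← nsmul_eq_mul]
    refine le_trans (card_nsmul_le_sum _ _ _ fun ω hω => ?_)
      (sum_le_sum_of_subset_of_nonneg (subset_univ _) fun _ _ _ => (Real.exp_pos _).le)
    exact Real.exp_le_exp.2 (mul_le_mul_of_nonneg_left (mem_filter.1 hω).2.le (by linarith))
  rw [← le_div_iff₀ (Real.exp_pos _)] at h1
  refine h1.trans ((div_le_div_of_nonneg_right h (Real.exp_pos _).le).trans ?_)
  rw [mul_div_right_comm, ← Real.exp_sub]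
  refine mul_le_mul_of_nonneg_right (Real.exp_le_exp.2 ?_) (Nat.cast_nonneg _)
  nlinarith [mul_le_mul_of_nonneg_left hμ (by positivity : 0 ≤ η / 2 + (η / 2) ^ 2)]

open scoped Classical in
theorem card_lower_tail_le [Nonempty α] (U : Finset κ) (I : κ → Finset ι)
    {E : κ → (ι → α) → Prop} {η p μ : ℝ} (hη : 0 ≤ η) (hη2 : η ≤ 2) (hp : 0 ≤ p)
    (hμ : p * #U = μ)
    (hdep : ∀ u ∈ U, ∀ u' ∈ U, u ≠ u' → ∀ ω ω', E u' ((I u).piecewise ω' ω) ↔ E u' ω)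
    (havg : ∀ u ∈ U, ∀ ω, p * Fintype.card (ι → α) ≤ #{ω' | E u ((I u).piecewise ω' ω)}) :
    (#{ω | #{u ∈ U | E u ω} < (1 - η) * μ} : ℝ)
      ≤ Real.exp (-(η ^ 2 * μ / 4)) * Fintype.card (ι → α) := by
  have h := sum_exp_card_le U I (s := -(η / 2))
    (by rw [abs_neg, abs_of_nonneg (by linarith)]; linarith) hp hdep
    (fun u hu ω => mul_le_mul_of_nonpos_left (havg u hu ω) (by linarith))
  have h1 : (#{ω | #{u ∈ U | E u ω} < (1 - η) * μ} : ℝ) * Real.exp (-(η / 2) * ((1 - η) * μ))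
      ≤ ∑ ω, Real.exp (-(η / 2) * #{u ∈ U | E u ω}) := by
    rw [← nsmul_eq_mul]
    refine le_trans (card_nsmul_le_sum _ _ _ fun ω hω => ?_)
      (sum_le_sum_of_subset_of_nonneg (subset_univ _) fun _ _ _ => (Real.exp_pos _).le)
    exact Real.exp_le_exp.2 (mul_le_mul_of_nonpos_left (mem_filter.1 hω).2.le (by linarith))
  rw [← le_div_iff₀ (Real.exp_pos _)] at h1
  refine h1.trans ((div_le_div_of_nonneg_right h (Real.exp_pos _).le).trans ?_)
  rw [mul_div_right_comm, ← Real.exp_sub, mul_assoc, hμ]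
  refine mul_le_mul_of_nonneg_right (Real.exp_le_exp.2 (le_of_eq ?_)) (Nat.cast_nonneg _)
  ring

end Tails

section Layering

open scoped Classical in
/-- A random map into `Fin K` splits all neighbourhoods and all punctured balls evenly. -/
theorem exists_balanced_layering {V : Type*} [Fintype V] [DecidableEq V] (G : SimpleGraph V)
    [DecidableRel G.Adj] (r K : ℕ) [NeZero K] {η δ : ℝ} (hη : 0 ≤ η) (hη2 : η ≤ 2)
    (hδ : ∀ v, δ ≤ G.degree v)
    (hexp : 8 * ((G.maxDegree + 1) ^ (2 * (r + 1)) * K) * Real.exp (-(η ^ 2 * (δ / K) / 4)) ≤ 1) :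
    ∃ l : V → Fin K, ∀ v j,
      (1 - η) * (G.degree v / K) ≤ #{w ∈ G.neighborFinset v | l w = j} ∧
      (#{u | (u ≠ v ∧ G.edist v u ≤ (r + 1 : ℕ)) ∧ l u = j} : ℝ)
        ≤ (1 + η) * (G.degree v * (G.maxDegree + 1) ^ r / K) := by
  have hK : (0 : ℝ) < K := by exact_mod_cast Nat.pos_of_ne_zero (NeZero.ne K)
  let S : V → Finset V := fun v => {u | u ≠ v ∧ G.edist v u ≤ (r + 1 : ℕ)}
  let bad : V × Fin K → (V → Fin K) → Prop := fun b l =>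
    #{w ∈ G.neighborFinset b.1 | l w = b.2} < (1 - η) * (G.degree b.1 / K) ∨
    (1 + η) * (G.degree b.1 * (G.maxDegree + 1) ^ r / K) < #{u ∈ S b.1 | l u = b.2}
  let vbl : V × Fin K → Set V := fun b => {u | G.edist b.1 u ≤ (r + 1 : ℕ)}
  have hNK : Fintype.card (Fin K) = K := Fintype.card_fin K
  have hdep : ∀ (U : Finset V) (j : Fin K), ∀ u ∈ U, ∀ u' ∈ U, u ≠ u' → ∀ l l' : V → Fin K,
      (({u} : Finset V).piecewise l' l) u' = j ↔ l u' = j := by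
    intro U j u _ u' _ huu' l l'
    rw [piecewise_eq_of_notMem _ _ _ (by simpa using huu'.symm)]
  have havg : ∀ (u : V) (j : Fin K) (l : V → Fin K),
      (#{l' : V → Fin K | (({u} : Finset V).piecewise l' l) u = j} : ℝ)
        = 1 / K * Fintype.card (V → Fin K) := by
    intro u j l
    simp only [piecewise_eq_of_mem _ _ _ (mem_singleton_self u)]
    have h := card_filter_coord_mul (ι := V) u (fun a : Fin K => a = j)
    have h1 : #{a : Fin K | a = j} = 1 := by
      rw [filter_eq', if_pos (mem_univ j), card_singleton]
    rw [h1, one_mul, hNK] at h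
    have h2 : (#{l' : V → Fin K | l' u = j} : ℝ) * K = Fintype.card (V → Fin K) := by
      exact_mod_cast h
    rw [← h2]
    field_simp
  have hS : ∀ v, (#(S v) : ℝ) ≤ G.degree v * (G.maxDegree + 1) ^ r := fun v => by
    exact_mod_cast card_filter_ne_and_edist_le G r v
  have htail : ∀ v, Real.exp (-(η ^ 2 * (G.degree v / K) / 4))
      ≤ Real.exp (-(η ^ 2 * (δ / K) / 4)) := fun v => by
    refine Real.exp_le_exp.2 (neg_le_neg ?_)
    have := hδ v
    gcongr
  have hpow : (1 : ℝ) ≤ (G.maxDegree + 1) ^ r :=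
    one_le_pow₀ (by linarith [Nat.cast_nonneg (α := ℝ) G.maxDegree])
  have htail' : ∀ v, Real.exp (-(η ^ 2 * (G.degree v * (G.maxDegree + 1) ^ r / K) / 4))
      ≤ Real.exp (-(η ^ 2 * (δ / K) / 4)) := fun v => by
    refine (Real.exp_le_exp.2 (neg_le_neg ?_)).trans (htail v)
    have : (G.degree v : ℝ) ≤ G.degree v * (G.maxDegree + 1) ^ r :=
      le_mul_of_one_le_right (Nat.cast_nonneg _) hpow
    gcongr
  obtain ⟨l, hl⟩ := exists_forall_not_of_local_lemma bad vbl
    (m := (G.maxDegree + 1) ^ (2 * (r + 1)) * K)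
    (Nat.mul_pos (pow_pos (Nat.succ_pos _) _) (Nat.pos_of_ne_zero (NeZero.ne K)))
    (by
      rintro ⟨v, j⟩ l l' h
      have h1 : ({w ∈ G.neighborFinset v | l w = j} : Finset V)
          = {w ∈ G.neighborFinset v | l' w = j} := by
        refine filter_congr fun w hw => ?_
        rw [h w]
        rw [SimpleGraph.mem_neighborFinset] at hw
        simp only [vbl, Set.mem_ofPred_eq]
        refine (SimpleGraph.edist_le hw.toWalk).trans ?_
        exact_mod_cast (by simp : 1 ≤ r + 1)
      have h2 : ({u ∈ S v | l u = j} : Finset V) = {u ∈ S v | l' u = j} := by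
        refine filter_congr fun w hw => ?_
        rw [h w]
        exact (mem_filter.1 hw).2.2
      simp only [bad, h1, h2])
    (by
      rintro ⟨v, j⟩
      have hsub : ({b' | ¬ Disjoint (vbl (v, j)) (vbl b')} : Finset (V × Fin K))
          ⊆ ({w | G.edist v w ≤ (2 * (r + 1) : ℕ)} : Finset V) ×ˢ univ := by
        rintro ⟨w, i⟩ h
        simp only [mem_filter, mem_univ, true_and, mem_product, and_true,
          Set.not_disjoint_iff] at h ⊢
        obtain ⟨x, hx, hx'⟩ := h
        simp only [vbl, Set.mem_ofPred_eq] at hx hx'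
        refine (G.edist_triangle (v := x)).trans ?_
        rw [SimpleGraph.edist_comm (u := x), two_mul, Nat.cast_add]
        exact add_le_add hx hx'
      refine (card_le_card hsub).trans ?_
      rw [card_product, Finset.card_univ, hNK]
      exact Nat.mul_le_mul_right _ (card_filter_edist_le G _ v))
    (by
      rintro ⟨v, j⟩
      have h1 := card_lower_tail_le (G.neighborFinset v) (fun u => {u})
        (E := fun u l => l u = j) (p := 1 / K) (μ := G.degree v / K) hη hη2 (by positivity)
        (by rw [SimpleGraph.card_neighborFinset_eq_degree]; ring) (hdep _ j)
        (fun u _ l => by rw [← havg u j l]; exact le_of_eq (by congr!))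
      have h2 := card_upper_tail_le (S v) (fun u => {u})
        (E := fun u l => l u = j) (p := 1 / K)
        (μ := G.degree v * (G.maxDegree + 1) ^ r / K) hη hη2 (by positivity)
        (by have := hS v; rw [one_div_mul_eq_div]; gcongr) (hdep _ j)
        (fun u _ l => by rw [← havg u j l]; exact le_of_eq (by congr!))
      set N := Fintype.card (V → Fin K) with hN
      have h3 : (#{l | bad (v, j) l} : ℝ) ≤ 2 * (Real.exp (-(η ^ 2 * (δ / K) / 4)) * N) := by
        have h4 : #{l | bad (v, j) l} ≤ _ + _ :=
          (card_le_card (filter_or _ _ _).subset).trans (card_union_le _ _)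
        have h5 := mul_le_mul_of_nonneg_right (htail v) (Nat.cast_nonneg (α := ℝ) N)
        have h6 := mul_le_mul_of_nonneg_right (htail' v) (Nat.cast_nonneg (α := ℝ) N)
        have h7 := (Nat.cast_le (α := ℝ)).2 h4
        rw [Nat.cast_add] at h7
        refine (h7.trans (by convert add_le_add h1 h2 <;> rfl)).trans ?_
        linarith
      have h4 : (4 * ((G.maxDegree + 1) ^ (2 * (r + 1)) * K) * #{l | bad (v, j) l} : ℝ) ≤ N := by
        calc _ ≤ (4 * ((G.maxDegree + 1) ^ (2 * (r + 1)) * K) : ℝ)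
              * (2 * (Real.exp (-(η ^ 2 * (δ / K) / 4)) * N)) := by gcongr
          _ = 8 * ((G.maxDegree + 1) ^ (2 * (r + 1)) * K) * Real.exp (-(η ^ 2 * (δ / K) / 4))
              * N := by ring
          _ ≤ 1 * N := by gcongr
          _ = N := one_mul _
      have h5 : 4 * ((G.maxDegree + 1) ^ (2 * (r + 1)) * K) * #{l | bad (v, j) l} ≤ N := by
        exact_mod_cast h4
      convert h5)
  refine ⟨l, fun v j => ?_⟩
  have h := hl (v, j)
  simp only [bad, not_or, not_lt] at h
  refine ⟨h.1, ?_⟩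
  have h2 := h.2
  simp only [S, filter_filter] at h2
  exact h2

end Layering

section FineColoring

variable {V : Type*}

open scoped Classical in
/-- The colour of an edge determined by a base colour and random digits: edges satisfying `τ` get
a free middle digit and a free leading bit, the others a free last digit. -/
noncomputable def fineColor {P X : ℕ} (τ : Sym2 V → Prop) (π : Sym2 V → ℕ)
    (ω : Sym2 V × Fin 3 → Fin P × Fin X × Fin 2) (e : Sym2 V) : ℕ :=
  if τ e then π e + P * ((ω (e, 0)).2.1 + X * (ω (e, 1)).2.2)
  else 2 * (P * X) + P * π e + (ω (e, 2)).1

variable {P X q : ℕ} {τ : Sym2 V → Prop} {π : Sym2 V → ℕ}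

theorem fineColor_lt_of_pos {ω : Sym2 V × Fin 3 → Fin P × Fin X × Fin 2} {e : Sym2 V}
    (he : π e < P) (hτ : τ e) : fineColor τ π ω e < 2 * (P * X) := by
  rw [fineColor, if_pos hτ]
  have h1 := (ω (e, 0)).2.1.2
  have h2 := (ω (e, 1)).2.2.2
  have h3 : ((ω (e, 0)).2.1 : ℕ) + X * (ω (e, 1)).2.2 + 1 ≤ 2 * X := by nlinarith
  have h4 := Nat.mul_le_mul_left P h3
  nlinarith

theorem le_fineColor_of_neg {ω : Sym2 V × Fin 3 → Fin P × Fin X × Fin 2} {e : Sym2 V}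
    (hτ : ¬ τ e) : 2 * (P * X) ≤ fineColor τ π ω e := by
  rw [fineColor, if_neg hτ]
  omega

theorem fineColor_lt {ω : Sym2 V × Fin 3 → Fin P × Fin X × Fin 2} {e : Sym2 V} (he : π e < P) :
    fineColor τ π ω e < 2 * (P * X) + P * P := by
  by_cases hτ : τ e
  · exact (fineColor_lt_of_pos he hτ).trans_le (Nat.le_add_right _ _)
  · rw [fineColor, if_neg hτ]
    have h1 := (ω (e, 2)).1.2
    have h2 := Nat.mul_le_mul_left P (show π e + 1 ≤ P from he)
    nlinarith

theorem fineColor_ne {ω : Sym2 V × Fin 3 → Fin P × Fin X × Fin 2} {e e' : Sym2 V}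
    (he : π e < P) (he' : π e' < P) (hne : π e ≠ π e') :
    fineColor τ π ω e ≠ fineColor τ π ω e' := by
  intro h
  by_cases hτ : τ e <;> by_cases hτ' : τ e'
  · rw [fineColor, fineColor, if_pos hτ, if_pos hτ'] at h
    have := congrArg (· % P) h
    simp only [Nat.add_mul_mod_self_left, Nat.mod_eq_of_lt he, Nat.mod_eq_of_lt he'] at this
    exact hne this
  · have h1 := fineColor_lt_of_pos (ω := ω) he hτ
    have h2 := le_fineColor_of_neg (π := π) (ω := ω) hτ'
    omega
  · have h1 := fineColor_lt_of_pos (ω := ω) he' hτ'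
    have h2 := le_fineColor_of_neg (π := π) (ω := ω) hτ
    omega
  · rw [fineColor, fineColor, if_neg hτ, if_neg hτ', add_assoc, add_assoc, add_right_inj] at h
    have := congrArg (· / P) h
    simp only [Nat.mul_add_div (pos_of_gt he), Nat.div_eq_of_lt (ω (e, 2)).1.2,
      Nat.div_eq_of_lt (ω (e', 2)).1.2, add_zero] at this
    exact hne this

variable [Fintype V] [DecidableEq V]

open scoped Classical in
theorem card_sum_fineColor_modEq_le [NeZero P] [NeZero X] [NeZero q] (G : SimpleGraph V)
    [DecidableRel G.Adj] {u w₀ w₂ : V} (h0 : w₀ ∈ G.neighborFinset u) (h0τ : τ s(u, w₀))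
    (h2 : w₂ ∈ G.neighborFinset u) (h2τ : ¬ τ s(u, w₂)) {ε : ℝ} (hε : 0 ≤ ε)
    (hJ : (1 - 1 / (4 * (q : ℝ) ^ 3)) ^ #{w ∈ G.neighborFinset u | τ s(u, w)} ≤ ε ^ 2)
    (I : Finset (Sym2 V × Fin 3))
    (hI : I = insert (s(u, w₂), 2) (insert (s(u, w₀), 0)
      ({w ∈ G.neighborFinset u | τ s(u, w)}.image fun w => (s(u, w), 1))))
    (ω : Sym2 V × Fin 3 → Fin P × Fin X × Fin 2) (a : ℕ) :
    (#{ω' | ∑ w ∈ G.neighborFinset u, (1 + fineColor τ π (I.piecewise ω' ω) s(u, w))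
        ≡ a [MOD P * X * q]} : ℝ)
      ≤ (1 / q + ε) / (P * X) * Fintype.card (Sym2 V × Fin 3 → Fin P × Fin X × Fin 2) := by
  set N₁ : Finset V := {w ∈ G.neighborFinset u | τ s(u, w)} with hN₁
  set N₂ : Finset V := {w ∈ G.neighborFinset u | ¬ τ s(u, w)} with hN₂
  set J : Finset (Sym2 V × Fin 3) := N₁.image fun w => (s(u, w), 1) with hJdef
  have hinj : Function.Injective fun w => ((s(u, w), 1) : Sym2 V × Fin 3) := fun w w' h =>
    Sym2.congr_right.1 (Prod.ext_iff.1 h).1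
  have hmem0 : ∀ w, (s(u, w), (0 : Fin 3)) ∈ I ↔ w = w₀ := by
    intro w
    simp [hI, hJdef]
    rintro h h'
    exact h'.trans h
  have hmem2 : ∀ w, (s(u, w), (2 : Fin 3)) ∈ I ↔ w = w₂ := by
    intro w
    simp [hI, hJdef]
    rintro h h'
    exact h'.trans h
  have hmem1 : ∀ w ∈ N₁, (s(u, w), (1 : Fin 3)) ∈ I := by
    intro w hw
    rw [hI]
    exact mem_insert_of_mem (mem_insert_of_mem (mem_image_of_mem _ hw))
  have hw0 : w₀ ∈ N₁ := mem_filter.2 ⟨h0, h0τ⟩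
  have hw2 : w₂ ∈ N₂ := mem_filter.2 ⟨h2, h2τ⟩
  have hform : ∀ ω', ∑ w ∈ G.neighborFinset u, (1 + fineColor τ π (I.piecewise ω' ω) s(u, w))
      = (∑ w ∈ N₁, (1 + π s(u, w)) + P * ∑ w ∈ N₁.erase w₀, ((ω (s(u, w), 0)).2.1 : ℕ)
        + ∑ w ∈ N₂, (1 + 2 * (P * X) + P * π s(u, w))
        + ∑ w ∈ N₂.erase w₂, ((ω (s(u, w), 2)).1 : ℕ))
        + ((ω' (s(u, w₂), 2)).1 + P * (ω' (s(u, w₀), 0)).2.1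
        + P * X * ∑ i ∈ J, ((ω' i).2.2 : ℕ)) := by
    intro ω'
    rw [← sum_filter_add_sum_filter_not (G.neighborFinset u) (fun w => τ s(u, w)), ← hN₁, ← hN₂]
    have e1 : ∑ w ∈ N₁, (1 + fineColor τ π (I.piecewise ω' ω) s(u, w))
        = ∑ w ∈ N₁, (1 + π s(u, w)) + P * ∑ w ∈ N₁, ((I.piecewise ω' ω (s(u, w), 0)).2.1 : ℕ)
          + P * X * ∑ w ∈ N₁, ((I.piecewise ω' ω (s(u, w), 1)).2.2 : ℕ) := by
      rw [mul_sum, mul_sum, ← sum_add_distrib, ← sum_add_distrib]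
      refine sum_congr rfl fun w hw => ?_
      rw [fineColor, if_pos (mem_filter.1 hw).2]
      ring
    have e2 : ∑ w ∈ N₂, (1 + fineColor τ π (I.piecewise ω' ω) s(u, w))
        = ∑ w ∈ N₂, (1 + 2 * (P * X) + P * π s(u, w))
          + ∑ w ∈ N₂, ((I.piecewise ω' ω (s(u, w), 2)).1 : ℕ) := by
      rw [← sum_add_distrib]
      refine sum_congr rfl fun w hw => ?_
      rw [fineColor, if_neg (mem_filter.1 hw).2]
      ring
    have e3 : ∑ w ∈ N₁, ((I.piecewise ω' ω (s(u, w), 0)).2.1 : ℕ)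
        = ∑ w ∈ N₁.erase w₀, ((ω (s(u, w), 0)).2.1 : ℕ) + (ω' (s(u, w₀), 0)).2.1 := by
      rw [← sum_erase_add _ _ hw0, piecewise_eq_of_mem _ _ _ ((hmem0 w₀).2 rfl)]
      congr 1
      refine sum_congr rfl fun w hw => ?_
      rw [piecewise_eq_of_notMem _ _ _ (fun h => ne_of_mem_erase hw ((hmem0 w).1 h))]
    have e4 : ∑ w ∈ N₂, ((I.piecewise ω' ω (s(u, w), 2)).1 : ℕ)
        = ∑ w ∈ N₂.erase w₂, ((ω (s(u, w), 2)).1 : ℕ) + (ω' (s(u, w₂), 2)).1 := by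
      rw [← sum_erase_add _ _ hw2, piecewise_eq_of_mem _ _ _ ((hmem2 w₂).2 rfl)]
      congr 1
      refine sum_congr rfl fun w hw => ?_
      rw [piecewise_eq_of_notMem _ _ _ (fun h => ne_of_mem_erase hw ((hmem2 w).1 h))]
    have e5 : ∑ w ∈ N₁, ((I.piecewise ω' ω (s(u, w), 1)).2.2 : ℕ) = ∑ i ∈ J, ((ω' i).2.2 : ℕ) := by
      rw [hJdef, sum_image hinj.injOn]
      refine sum_congr rfl fun w hw => ?_
      rw [piecewise_eq_of_mem _ _ _ (hmem1 w hw)]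
    rw [e1, e2, e3, e4, e5]
    ring
  simp only [hform]
  refine card_digits_modEq_le (i₂ := (s(u, w₂), (2 : Fin 3))) (i₀ := (s(u, w₀), (0 : Fin 3)))
    ?_ ?_ ?_ hε ?_ _ _
  · simp
  · simp [hJdef]
  · simp [hJdef]
  · rwa [hJdef, card_image_of_injective _ hinj]

open scoped Classical in
theorem exists_fine_coloring [NeZero P] [NeZero X] [NeZero q] (G : SimpleGraph V)
    [DecidableRel G.Adj] (r : ℕ) {K : ℕ} [NeZero K] (l : V → Fin K) (τ : Sym2 V → Prop)
    (π : Sym2 V → ℕ) {η δ : ℝ} (hη : 0 ≤ η) (hη2 : η ≤ 2)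
    (hτ : ∀ u, ∀ w ∈ G.neighborFinset u, τ s(u, w) → l w ≠ l u)
    (hτ₁ : ∀ u, ∃ w ∈ G.neighborFinset u, τ s(u, w))
    (hτ₂ : ∀ u, ∃ w ∈ G.neighborFinset u, ¬ τ s(u, w) ∧ l w ≠ l u)
    (hJ : ∀ u, (1 - 1 / (4 * (q : ℝ) ^ 3)) ^ #{w ∈ G.neighborFinset u | τ s(u, w)}
      ≤ (η / q) ^ 2)
    (hball : ∀ v j, (#{u | (u ≠ v ∧ G.edist v u ≤ (r + 1 : ℕ)) ∧ l u = j} : ℝ)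
      ≤ (1 + η) * (G.degree v * (G.maxDegree + 1) ^ r / K))
    (hδ : ∀ v, δ ≤ G.degree v)
    (hexp : 4 * ((G.maxDegree + 1) ^ (2 * r + 3) * (K * (P * X * q)))
      * Real.exp (-(η ^ 2 * (δ * (G.maxDegree + 1) ^ r / (K * (P * X * q))) / 4)) ≤ 1) :
    ∃ f : Sym2 V → ℕ, (∀ e, π e < P → f e < 2 * (P * X) + P * P) ∧
      (∀ e e', π e < P → π e' < P → π e ≠ π e' → f e ≠ f e') ∧
      ∀ v j a, (#{u | ((u ≠ v ∧ G.edist v u ≤ (r + 1 : ℕ)) ∧ l u = j) ∧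
          ∑ w ∈ G.neighborFinset u, (1 + f s(u, w)) ≡ a [MOD P * X * q]} : ℝ)
        ≤ (1 + η) ^ 3 * (G.degree v * (G.maxDegree + 1) ^ r / (K * (P * X * q))) := by
  have hK : (0 : ℝ) < K := by exact_mod_cast Nat.pos_of_ne_zero (NeZero.ne K)
  have hP : (0 : ℝ) < P := by exact_mod_cast Nat.pos_of_ne_zero (NeZero.ne P)
  have hX : (0 : ℝ) < X := by exact_mod_cast Nat.pos_of_ne_zero (NeZero.ne X)
  have hq : (0 : ℝ) < q := by exact_mod_cast Nat.pos_of_ne_zero (NeZero.ne q)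
  choose w₀ hw₀ hw₀τ using hτ₁
  choose w₂ hw₂ hw₂τ hw₂l using hτ₂
  let S : V → Fin K → Finset V := fun v j => {u | (u ≠ v ∧ G.edist v u ≤ (r + 1 : ℕ)) ∧ l u = j}
  let μ : V → ℝ := fun v =>
    (1 + η) ^ 2 * (G.degree v * (G.maxDegree + 1) ^ r / (K * (P * X * q)))
  let E : ℕ → V → (Sym2 V × Fin 3 → Fin P × Fin X × Fin 2) → Prop := fun a u ω =>
    ∑ w ∈ G.neighborFinset u, (1 + fineColor τ π ω s(u, w)) ≡ a [MOD P * X * q]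
  let bad : V × Fin K × Fin (P * X * q) → (Sym2 V × Fin 3 → Fin P × Fin X × Fin 2) → Prop :=
    fun b ω => (1 + η) * μ b.1 < #{u ∈ S b.1 b.2.1 | E b.2.2 u ω}
  let vbl : V × Fin K × Fin (P * X * q) → Set (Sym2 V × Fin 3) :=
    fun b => {i | i.1 ∈ G.edgeSet ∧ ∃ u ∈ i.1, G.edist b.1 u ≤ (r + 1 : ℕ)}
  let I : V → Finset (Sym2 V × Fin 3) := fun u =>
    insert (s(u, w₂ u), 2) (insert (s(u, w₀ u), 0)
      ({w ∈ G.neighborFinset u | τ s(u, w)}.image fun w => (s(u, w), 1)))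
  have hE : ∀ a u (ω ω' : Sym2 V × Fin 3 → Fin P × Fin X × Fin 2),
      (∀ w ∈ G.neighborFinset u, ∀ k, ω (s(u, w), k) = ω' (s(u, w), k)) → (E a u ω ↔ E a u ω') := by
    intro a u ω ω' h
    have : ∑ w ∈ G.neighborFinset u, (1 + fineColor τ π ω s(u, w))
        = ∑ w ∈ G.neighborFinset u, (1 + fineColor τ π ω' s(u, w)) :=
      sum_congr rfl fun w hw => by
        simp only [fineColor, h w hw]
    simp only [E, this]
  have hIl : ∀ u u', l u = l u' → u ≠ u' → ∀ w k, (s(u', w), k) ∉ I u := by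
    intro u u' hl hne w k h
    have key : ∀ x, l x ≠ l u → s(u', w) = s(u, x) → False := by
      intro x hx h
      rcases Sym2.eq_iff.1 h with ⟨h, -⟩ | ⟨h, -⟩
      · exact hne h.symm
      · exact hx (h ▸ hl.symm)
    simp only [I, mem_insert, mem_image, mem_filter, Prod.mk.injEq] at h
    rcases h with h | h | ⟨x, ⟨hx, hxτ⟩, h⟩
    · exact key _ (hw₂l u) h.1
    · exact key _ (hτ u _ (hw₀ u) (hw₀τ u)) h.1
    · exact key _ (hτ u x hx hxτ) h.1.symm
  have hR : (0 : ℝ) < (G.maxDegree + 1) ^ r := by positivity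
  have hμδ : ∀ v, δ * (G.maxDegree + 1) ^ r / (K * (P * X * q)) ≤ μ v := by
    intro v
    have h1 : δ * (G.maxDegree + 1) ^ r / (K * (P * X * q))
        ≤ G.degree v * (G.maxDegree + 1) ^ r / (K * (P * X * q)) := by
      have := hδ v
      gcongr
    refine h1.trans (le_mul_of_one_le_left (by positivity) ?_)
    nlinarith
  obtain ⟨ω, hω⟩ := exists_forall_not_of_local_lemma bad vbl
    (m := (G.maxDegree + 1) ^ (2 * r + 3) * (K * (P * X * q)))
    (Nat.pos_of_ne_zero (by
      have := NeZero.ne K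
      have := NeZero.ne P
      have := NeZero.ne X
      have := NeZero.ne q
      positivity))
    (by
      rintro ⟨v, j, a⟩ ω ω' h
      have : ({u ∈ S v j | E a u ω} : Finset V) = {u ∈ S v j | E a u ω'} := by
        refine filter_congr fun u hu => hE _ _ _ _ fun w hw k => h _ ?_
        refine ⟨by simpa using hw, u, Sym2.mem_mk_left u w, ?_⟩
        exact (mem_filter.1 hu).2.1.2
      simp only [bad, this])
    (by
      rintro ⟨v, j, a⟩
      have hsub : ({b' | ¬ Disjoint (vbl (v, j, a)) (vbl b')} :
          Finset (V × Fin K × Fin (P * X * q)))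
          ⊆ ({w | G.edist v w ≤ (2 * r + 3 : ℕ)} : Finset V) ×ˢ univ := by
        rintro ⟨w, i⟩ h
        simp only [mem_filter, mem_univ, true_and, mem_product, and_true,
          Set.not_disjoint_iff] at h ⊢
        obtain ⟨⟨e, k⟩, ⟨he, x, hx, hvx⟩, ⟨-, y, hy, hwy⟩⟩ := h
        have hxy : G.edist x y ≤ (1 : ℕ) := by
          by_cases h : x = y
          · subst h; simp
          · have : e = s(x, y) := (Sym2.mem_and_mem_iff h).1 ⟨hx, hy⟩
            rw [this, SimpleGraph.mem_edgeSet] at he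
            exact SimpleGraph.edist_le he.toWalk
        refine (G.edist_triangle (v := y)).trans ?_
        rw [SimpleGraph.edist_comm (u := y)]
        have h1 := (G.edist_triangle (u := v) (v := x) (w := y)).trans (add_le_add hvx hxy)
        refine (add_le_add h1 hwy).trans ?_
        exact_mod_cast (by omega : r + 1 + 1 + (r + 1) ≤ 2 * r + 3)
      refine (card_le_card hsub).trans ?_
      rw [card_product, Finset.card_univ, Fintype.card_prod, Fintype.card_fin, Fintype.card_fin]
      exact Nat.mul_le_mul_right _ (card_filter_edist_le G _ v))
    (by
      rintro ⟨v, j, a⟩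
      have h1 := card_upper_tail_le (S v j) I (E := E a) (η := η)
        (p := (1 / q + η / q) / (P * X)) (μ := μ v) hη hη2 (by positivity)
        (by
          refine (mul_le_mul_of_nonneg_left (hball v j) (by positivity)).trans (le_of_eq ?_)
          simp only [μ]
          field_simp)
        (by
          intro u hu u' hu' hne ω ω'
          refine hE _ _ _ _ fun w hw k => ?_
          rw [piecewise_eq_of_notMem]
          exact hIl u u' ((mem_filter.1 hu).2.2.trans (mem_filter.1 hu').2.2.symm) hne w k)
        (fun u hu ω => by
          refine le_trans (le_of_eq ?_) (card_sum_fineColor_modEq_le G (π := π) (hw₀ u) (hw₀τ u)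
            (hw₂ u) (hw₂τ u) (show 0 ≤ η / q by positivity) (hJ u) (I u) rfl ω a)
          simp only [E])
      set N := Fintype.card (Sym2 V × Fin 3 → Fin P × Fin X × Fin 2) with hN
      have h2 : Real.exp (-(η ^ 2 * μ v / 4)) ≤ Real.exp
          (-(η ^ 2 * (δ * (G.maxDegree + 1) ^ r / (K * (P * X * q))) / 4)) := by
        refine Real.exp_le_exp.2 (neg_le_neg ?_)
        have := hμδ v
        gcongr
      have h3 : (#{ω | bad (v, j, a) ω} : ℝ) ≤ Real.exp
          (-(η ^ 2 * (δ * (G.maxDegree + 1) ^ r / (K * (P * X * q))) / 4)) * N := by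
        refine le_trans ?_ (h1.trans (mul_le_mul_of_nonneg_right h2 (Nat.cast_nonneg _)))
        exact le_of_eq (by congr!)
      have h4 : (4 * ((G.maxDegree + 1) ^ (2 * r + 3) * (K * (P * X * q)))
          * #{ω | bad (v, j, a) ω} : ℝ) ≤ N := by
        refine (mul_le_mul_of_nonneg_left h3 (by positivity)).trans ?_
        rw [← mul_assoc]
        exact mul_le_of_le_one_left (Nat.cast_nonneg _) hexp
      exact_mod_cast h4)
  refine ⟨fineColor τ π ω, fun e he => fineColor_lt he, fun e e' he he' h => fineColor_ne he he' h,
    fun v j a => ?_⟩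
  have hD : 0 < P * X * q := Nat.pos_of_ne_zero (by
      have := NeZero.ne P
      have := NeZero.ne X
      have := NeZero.ne q
      positivity)
  have h := hω (v, j, ⟨a % (P * X * q), Nat.mod_lt _ hD⟩)
  simp only [bad, not_lt, S, filter_filter, E, Nat.ModEq, Nat.mod_mod, μ] at h
  refine le_trans (le_of_eq ?_) (h.trans (le_of_eq (by ring)))
  simp only [Nat.ModEq]
  congr!

end FineColoring

section Assembly

variable {V : Type*} [Fintype V]

theorem exists_injective_nat_of_layering (l : V → ℕ) :
    ∃ ρ : V → ℕ, Function.Injective ρ ∧ ∀ u v, l u < l v → ρ u < ρ v := by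
  let e := Fintype.equivFin V
  refine ⟨fun v => l v * Fintype.card V + e v, fun u v h => ?_, fun u v h => ?_⟩
  · have := congrArg (· % Fintype.card V) h
    simp only [Nat.mul_add_mod_self_right, Nat.mod_eq_of_lt (e _).2] at this
    exact e.injective (Fin.ext this)
  · have h1 := (e u).2
    have h2 : (l u + 1) * Fintype.card V ≤ l v * Fintype.card V := Nat.mul_le_mul_right _ h
    have h3 := add_one_mul (l u) (Fintype.card V)
    dsimp only
    omega

theorem mul_le_card_filter_of_fibers {V ι : Type*} [DecidableEq ι] (s : Finset V) (l : V → ι)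
    {c : ℝ} (hc : ∀ j, c ≤ #{w ∈ s | l w = j}) {J : Finset ι} {O : Finset V}
    (hO : ∀ w ∈ s, l w ∈ J → w ∈ O) : #J * c ≤ #O := by
  classical
  have h1 : ∑ j ∈ J, #{w ∈ s | l w = j} ≤ #O := by
    rw [← card_biUnion]
    · refine card_le_card fun w hw => ?_
      simp only [mem_biUnion, mem_filter] at hw
      obtain ⟨j, hj, hw, rfl⟩ := hw
      exact hO w hw hj
    · intro i _ j _ hij
      refine disjoint_left.2 fun w hw hw' => hij ?_
      rw [← (mem_filter.1 hw).2, (mem_filter.1 hw').2]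
  calc #J * c = ∑ j ∈ J, c := by rw [sum_const, nsmul_eq_mul]
    _ ≤ ∑ j ∈ J, (#{w ∈ s | l w = j} : ℝ) := sum_le_sum fun j _ => hc j
    _ ≤ #O := by exact_mod_cast h1

/-- In a balanced layering with `q ^ 2 + q` layers, every edge can be given to one of its ends so
that each vertex owns enough edges. -/
theorem exists_ownership [DecidableEq V] (G : SimpleGraph V) [DecidableRel G.Adj] {q : ℕ}
    (hq : 2 ≤ q) (l : V → Fin (q ^ 2 + q)) {ρ : V → ℕ} (hρ : ∀ u v, l u < l v → ρ u < ρ v)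
    {x : V → ℝ} (hx : ∀ v, 0 ≤ x v)
    (hl : ∀ v j, (1 - 1 / (8 * (q : ℝ))) * x v ≤ #{w ∈ G.neighborFinset v | l w = j}) :
    ∃ O : V → Finset V, (∀ v, O v ⊆ G.neighborFinset v) ∧ (∀ v w, w ∈ O v → v ∉ O w) ∧
      ∀ v, ((l v : ℕ) + 1) * (1 - 2 / (q : ℝ)) * x v ≤ #(O v) := by
  classical
  have hq0 : (2 : ℝ) ≤ q := by exact_mod_cast hq
  let A : V → V → Prop := fun v w => (l v : ℕ) < q ∧ q ^ 2 ≤ (l w : ℕ)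
  have hqq : q ≤ q ^ 2 := by nlinarith
  refine ⟨fun v => {w ∈ G.neighborFinset v | A v w ∨ (¬ A w v ∧ ρ w < ρ v)},
    fun v => filter_subset _ _, fun v w hw hv => ?_, fun v => ?_⟩
  · have h1 := (mem_filter.1 hw).2
    have h2 := (mem_filter.1 hv).2
    simp only [A] at h1 h2
    omega
  have key : ∀ (J : Finset (Fin (q ^ 2 + q))) (n : ℕ), #J = n →
      ((l v : ℕ) + 1) * (1 - 2 / (q : ℝ)) ≤ n * (1 - 1 / (8 * (q : ℝ))) →
      (∀ w, l w ∈ J → A v w ∨ (¬ A w v ∧ ρ w < ρ v)) →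
      ((l v : ℕ) + 1) * (1 - 2 / (q : ℝ)) * x v
        ≤ #{w ∈ G.neighborFinset v | A v w ∨ (¬ A w v ∧ ρ w < ρ v)} := by
    intro J n hJ hn hw
    refine (mul_le_mul_of_nonneg_right hn (hx v)).trans ?_
    rw [mul_assoc, ← hJ]
    exact mul_le_card_filter_of_fibers (G.neighborFinset v) l (hl v)
      fun w hw' hwJ => mem_filter.2 ⟨hw', hw w hwJ⟩
  have hlv := (l v).2
  have e1 : ∀ y : ℝ, y * (1 - 2 / (q : ℝ)) = y - 2 * (y / q) := fun y => by ring
  have e2 : ∀ y : ℝ, y * (1 - 1 / (8 * (q : ℝ))) = y - 1 / 8 * (y / q) := fun y => by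
    field_simp
  rcases lt_or_ge (l v : ℕ) q with h1 | h1
  · refine key (univ.filter fun j => q ^ 2 ≤ (j : ℕ)) q ?_ ?_ ?_
    · have := Fin.card_filter_val_lt (n := q ^ 2 + q) (m := q ^ 2)
      have h3 := card_filter_add_card_filter_not (s := (univ : Finset (Fin (q ^ 2 + q))))
        fun j => (j : ℕ) < q ^ 2
      simp only [not_lt, Finset.card_univ, Fintype.card_fin] at h3
      have h4 : min (q ^ 2) (q ^ 2 + q) = q ^ 2 := by simp
      omega
    · have h2 : ((l v : ℕ) : ℝ) + 1 ≤ q := by exact_mod_cast h1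
      have h3 : (0 : ℝ) ≤ 1 - 2 / q := by
        rw [sub_nonneg, div_le_one (by linarith)]
        exact hq0
      refine mul_le_mul h2 ?_ h3 (by linarith)
      rw [sub_le_sub_iff_left, div_le_div_iff₀ (by linarith) (by linarith)]
      linarith
    · intro w hw
      exact Or.inl ⟨h1, (mem_filter.1 hw).2⟩
  rcases lt_or_ge (l v : ℕ) (q ^ 2) with h2 | h2
  · refine key (Iio (l v)) (l v) (Fin.card_Iio _) ?_ ?_
    · have h3 : (q : ℝ) ≤ (l v : ℕ) := by exact_mod_cast h1
      have h4 : 1 ≤ ((l v : ℕ) : ℝ) / q := (one_le_div (by linarith)).2 h3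
      have h5 : 0 < 1 / (q : ℝ) := by positivity
      rw [e1, e2, add_div]
      linarith
    · intro w hw
      exact Or.inr ⟨fun h => by simp only [A] at h; omega, hρ _ _ (mem_Iio.1 hw)⟩
  · refine key (Ico ⟨q, by nlinarith⟩ (l v)) (l v - q) (Fin.card_Ico _ _) ?_ ?_
    · rw [Nat.cast_sub h1]
      have h3 : (q : ℝ) ^ 2 ≤ (l v : ℕ) := by exact_mod_cast h2
      have h4 : (q : ℝ) ≤ ((l v : ℕ) : ℝ) / q := by
        rw [le_div_iff₀ (by linarith)]
        linarith
      have h5 : 0 < 1 / (q : ℝ) := by positivity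
      have h6 : (q : ℝ) / q = 1 := div_self (by linarith)
      rw [e1, e2, add_div, sub_div, h6]
      linarith
    · intro w hw
      have hw := mem_Ico.1 hw
      refine Or.inr ⟨fun h => ?_, hρ _ _ hw.2⟩
      have := Fin.le_def.1 hw.1
      simp only [A] at h this
      omega

end Assembly

section Combination

variable {V : Type*} [Fintype V] [DecidableEq V]

theorem one_sub_pow_le_of_exp {q n : ℕ} (hq : 2 ≤ q) (hn : q ^ 4 ≤ n)
    (hqexp : 64 * (q : ℝ) ^ 4 ≤ Real.exp (q / 4)) :
    (1 - 1 / (4 * (q : ℝ) ^ 3)) ^ n ≤ (1 / (8 * q) / q) ^ 2 := by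
  have hq0 : (2 : ℝ) ≤ q := by exact_mod_cast hq
  have hq3 : (1 : ℝ) ≤ (q : ℝ) ^ 3 := one_le_pow₀ (by linarith)
  have h0 : (0 : ℝ) ≤ 1 - 1 / (4 * (q : ℝ) ^ 3) := by
    rw [sub_nonneg, div_le_one (by linarith)]
    linarith
  have h1 : (1 - 1 / (4 * (q : ℝ) ^ 3)) ≤ Real.exp (-(1 / (4 * (q : ℝ) ^ 3))) :=
    Real.one_sub_le_exp_neg _
  have h2 : (1 - 1 / (4 * (q : ℝ) ^ 3)) ≤ 1 := by
    rw [sub_le_self_iff]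
    positivity
  calc (1 - 1 / (4 * (q : ℝ) ^ 3)) ^ n ≤ (1 - 1 / (4 * (q : ℝ) ^ 3)) ^ q ^ 4 :=
        pow_le_pow_of_le_one h0 h2 hn
    _ ≤ Real.exp (-(1 / (4 * (q : ℝ) ^ 3))) ^ q ^ 4 := pow_le_pow_left₀ h0 h1 _
    _ = (Real.exp (q / 4))⁻¹ := by
        rw [← Real.exp_nat_mul, ← Real.exp_neg]
        congr 1
        push_cast
        field_simp
    _ ≤ (64 * (q : ℝ) ^ 4)⁻¹ := inv_anti₀ (by positivity) hqexp
    _ = (1 / (8 * q) / q) ^ 2 := by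
        field_simp
        norm_num

theorem distSumDistinguishing_of_bounds (G : SimpleGraph V) [DecidableRel G.Adj] {r q P X : ℕ}
    [NeZero P] [NeZero X] {δ : ℝ} (hq : 2 ≤ q) (hP : 2 * G.maxDegree ≤ P)
    (hM : 2 * (P * X) + P * P ≤ P * X * q) (hδ : ∀ v, δ ≤ G.degree v)
    (hδq : (q : ℝ) ^ 4 ≤ (1 - 1 / (8 * q)) * (δ / (q ^ 2 + q : ℕ)))
    (hqexp : 64 * (q : ℝ) ^ 4 ≤ Real.exp (q / 4))
    (hlayer : 8 * ((G.maxDegree + 1) ^ (2 * (r + 1)) * (q ^ 2 + q : ℕ))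
      * Real.exp (-((1 / (8 * q)) ^ 2 * (δ / (q ^ 2 + q : ℕ)) / 4)) ≤ 1)
    (hfine : 4 * ((G.maxDegree + 1) ^ (2 * r + 3) * ((q ^ 2 + q : ℕ) * (P * X * q)))
      * Real.exp (-((1 / (8 * q)) ^ 2
        * (δ * (G.maxDegree + 1) ^ r / ((q ^ 2 + q : ℕ) * (P * X * q))) / 4)) ≤ 1)
    (hD : 2 * ((1 + 1 / (8 * q)) ^ 3 * (G.maxDegree + 1) ^ r)
      ≤ (1 - 2 / (q : ℝ)) * (P * X * q)) :
    DistSumDistinguishing G (r + 1) (2 * (P * X * q) + (2 * (P * X) + P * P)) := by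
  classical
  have hq0 : (2 : ℝ) ≤ q := by exact_mod_cast hq
  have : NeZero q := ⟨by omega⟩
  have : NeZero (q ^ 2 + q) := ⟨by nlinarith⟩
  have hP0 : (0 : ℝ) < P := by exact_mod_cast Nat.pos_of_ne_zero (NeZero.ne P)
  have hX0 : (0 : ℝ) < X := by exact_mod_cast Nat.pos_of_ne_zero (NeZero.ne X)
  have hD0 : 0 < P * X * q := Nat.pos_of_ne_zero (by
    have := NeZero.ne P
    have := NeZero.ne X
    have := NeZero.ne q
    positivity)
  set K := q ^ 2 + q with hK
  have hK0 : (0 : ℝ) < K := by exact_mod_cast Nat.pos_of_ne_zero (NeZero.ne K)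
  have hη : (0 : ℝ) ≤ 1 / (8 * q) := by positivity
  have hη1 : 1 / (8 * (q : ℝ)) ≤ 1 := by
    rw [div_le_one (by linarith)]
    linarith
  obtain ⟨l, hl⟩ := exists_balanced_layering G r K hη (hη1.trans one_le_two) hδ hlayer
  have hlarge : ∀ v j, q ^ 4 ≤ #{w ∈ G.neighborFinset v | l w = j} := by
    intro v j
    have h1 := (hl v j).1
    have h2 : (1 - 1 / (8 * (q : ℝ))) * (δ / K) ≤ (1 - 1 / (8 * q)) * (G.degree v / K) := by
      have := hδ v
      refine mul_le_mul_of_nonneg_left ?_ (by linarith)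
      gcongr
    exact_mod_cast hδq.trans (h2.trans h1)
  have hnonempty : ∀ v j, ∃ w ∈ G.neighborFinset v, l w = j := by
    intro v j
    have h1 : 0 < q ^ 4 := by positivity
    obtain ⟨w, hw⟩ := card_pos.1 (h1.trans_le (hlarge v j))
    exact ⟨w, (mem_filter.1 hw).1, (mem_filter.1 hw).2⟩
  obtain ⟨τ, hτ⟩ : ∃ τ : Sym2 V → Prop, ∀ u w, τ s(u, w) ↔ Odd ((l u : ℕ) + l w) :=
    ⟨fun e => Odd (Sym2.lift ⟨fun u w => (l u : ℕ) + l w, fun u w => add_comm _ _⟩ e),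
      fun u w => by simp only [Sym2.lift_mk]⟩
  have hlayer₁ : ∀ u, ∃ j : Fin K, Odd ((l u : ℕ) + j) := by
    intro u
    have := (l u).2
    rcases Nat.eq_zero_or_pos (l u) with h | h
    · exact ⟨⟨1, by nlinarith⟩, ⟨0, by simp [h]⟩⟩
    · refine ⟨⟨l u - 1, by omega⟩, ⟨l u - 1, ?_⟩⟩
      dsimp only
      omega
  have hlayer₂ : ∀ u, ∃ j : Fin K, ¬ Odd ((l u : ℕ) + j) ∧ j ≠ l u := by
    intro u
    have := (l u).2
    rcases lt_or_ge (l u : ℕ) 2 with h | h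
    · refine ⟨⟨l u + 2, by nlinarith⟩, ?_, ?_⟩
      · rw [Nat.not_odd_iff_even]
        exact ⟨l u + 1, by dsimp only; omega⟩
      · rw [Ne, Fin.ext_iff]
        dsimp only
        omega
    · refine ⟨⟨l u - 2, by omega⟩, ?_, ?_⟩
      · rw [Nat.not_odd_iff_even]
        exact ⟨l u - 1, by dsimp only; omega⟩
      · rw [Ne, Fin.ext_iff]
        dsimp only
        omega
  obtain ⟨π, hπ, hπne⟩ := exists_properEdgeColoring_lt G
  have hπP : ∀ e ∈ G.edgeSet, π e < P := fun e he => (hπ e he).trans_le hP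
  obtain ⟨f, hf, hfne, hfine⟩ := exists_fine_coloring (P := P) (X := X) (q := q) G r l τ π hη
    (hη1.trans one_le_two)
    (by
      intro u w _ h h'
      rw [hτ, h'] at h
      exact Nat.not_odd_iff_even.2 ⟨_, rfl⟩ h)
    (by
      intro u
      obtain ⟨j, hj⟩ := hlayer₁ u
      obtain ⟨w, hw, hwj⟩ := hnonempty u j
      exact ⟨w, hw, (hτ u w).2 (by rwa [hwj])⟩)
    (by
      intro u
      obtain ⟨j, hj, hju⟩ := hlayer₂ u
      obtain ⟨w, hw, hwj⟩ := hnonempty u j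
      exact ⟨w, hw, by rwa [hτ, hwj], by rwa [hwj]⟩)
    (by
      intro u
      obtain ⟨j, hj⟩ := hlayer₁ u
      refine one_sub_pow_le_of_exp hq ((hlarge u j).trans (card_le_card fun w hw => ?_)) hqexp
      rw [mem_filter] at hw ⊢
      exact ⟨hw.1, (hτ u w).2 (by rwa [hw.2])⟩)
    (fun v j => by
      refine le_trans (le_of_eq ?_) (hl v j).2
      congr!)
    hδ hfine
  obtain ⟨ρ, hρ, hlρ⟩ := exists_injective_nat_of_layering fun v => (l v : ℕ)
  obtain ⟨O, hO, hO', hcard⟩ := exists_ownership G hq l (ρ := ρ) (fun u v h => hlρ u v h)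
    (x := fun v => G.degree v / K) (fun v => by positivity) (fun v j => by
      refine (hl v j).1.trans (le_of_eq ?_)
      congr!)
  let F : V → ℕ := fun u => ∑ w ∈ G.neighborFinset u, (1 + f s(u, w))
  let H : V → V → Prop := fun u v =>
    (u ≠ v ∧ G.edist v u ≤ (r + 1 : ℕ)) ∧ F u ≡ F v [MOD P * X * q]
  have hconf : ∀ v, 2 * #{u | ρ u < ρ v ∧ H u v} ≤ #(O v) := by
    intro v
    have hsub : ({u | ρ u < ρ v ∧ H u v} : Finset V) ⊆ (Iic (l v)).biUnion fun j =>
        {u | ((u ≠ v ∧ G.edist v u ≤ (r + 1 : ℕ)) ∧ l u = j) ∧ F u ≡ F v [MOD P * X * q]} := by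
      intro u hu
      obtain ⟨-, hu, hH⟩ := mem_filter.1 hu
      refine mem_biUnion.2 ⟨l u, mem_Iic.2 ?_, mem_filter.2 ⟨mem_univ _, ⟨hH.1, rfl⟩, hH.2⟩⟩
      by_contra h
      exact hu.asymm (hlρ _ _ (Fin.lt_def.1 (not_le.1 h)))
    have h1 : (#{u | ρ u < ρ v ∧ H u v} : ℝ) ≤ ((l v : ℕ) + 1) *
        ((1 + 1 / (8 * (q : ℝ))) ^ 3
          * (G.degree v * (G.maxDegree + 1) ^ r / (K * (P * X * q)))) := by
      have h2 := (card_le_card hsub).trans card_biUnion_le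
      calc (#{u | ρ u < ρ v ∧ H u v} : ℝ) ≤ ∑ j ∈ Iic (l v),
            (#{u | ((u ≠ v ∧ G.edist v u ≤ (r + 1 : ℕ)) ∧ l u = j)
              ∧ F u ≡ F v [MOD P * X * q]} : ℝ) := by exact_mod_cast h2
        _ ≤ ∑ j ∈ Iic (l v), (1 + 1 / (8 * (q : ℝ))) ^ 3
              * (G.degree v * (G.maxDegree + 1) ^ r / (K * (P * X * q))) :=
            sum_le_sum fun j _ => (le_of_eq (by congr!)).trans (hfine v j (F v))
        _ = _ := by
            rw [sum_const, Fin.card_Iic, nsmul_eq_mul]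
            push_cast
            ring
    have h3 : 2 * (((l v : ℕ) + 1) * ((1 + 1 / (8 * (q : ℝ))) ^ 3
          * (G.degree v * (G.maxDegree + 1) ^ r / (K * (P * X * q)))))
        ≤ ((l v : ℕ) + 1) * (1 - 2 / (q : ℝ)) * (G.degree v / K) := by
      have h4 : 2 * ((1 + 1 / (8 * (q : ℝ))) ^ 3 * (G.maxDegree + 1) ^ r) / (P * X * q)
          ≤ 1 - 2 / (q : ℝ) := (div_le_iff₀ (by positivity)).2 hD
      calc _ = ((l v : ℕ) + 1) * (2 * ((1 + 1 / (8 * (q : ℝ))) ^ 3 * (G.maxDegree + 1) ^ r)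
            / (P * X * q)) * (G.degree v / K) := by
              field_simp
        _ ≤ _ := by gcongr
    have h5 := (mul_le_mul_of_nonneg_left h1 zero_le_two).trans (h3.trans (hcard v))
    exact_mod_cast h5
  obtain ⟨b, hb, hbne⟩ := exists_weight_ne_of_two_mul_card_le G hρ (fun v => F v / (P * X * q)) H O
    hO hO' (fun v => (Nat.le_of_eq (by congr!)).trans (hconf v))
  have hmain : ∀ u v, ρ u < ρ v → G.edist v u ≤ (r + 1 : ℕ) →
      ∑ w ∈ G.neighborFinset u, (1 + f s(u, w) + P * X * q * b s(u, w))
        ≠ ∑ w ∈ G.neighborFinset v, (1 + f s(v, w) + P * X * q * b s(v, w)) := by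
    intro u v huv hdist h
    have hsum : ∀ u, ∑ w ∈ G.neighborFinset u, (1 + f s(u, w) + P * X * q * b s(u, w))
        = F u + P * X * q * ∑ w ∈ G.neighborFinset u, b s(u, w) := fun u => by
      rw [sum_add_distrib, mul_sum]
    rw [hsum, hsum] at h
    have hmod : F u ≡ F v [MOD P * X * q] := by
      have := congrArg (· % (P * X * q)) h
      simpa only [Nat.add_mul_mod_self_left, Nat.ModEq] using this
    have hdiv := congrArg (· / (P * X * q)) h
    simp only [Nat.add_mul_div_left _ _ hD0] at hdiv
    exact hbne u v huv ⟨⟨fun h => huv.ne (congrArg ρ h), hdist⟩, hmod⟩ hdiv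
  refine ⟨fun e => 1 + f e + P * X * q * b e, fun e he => ⟨by dsimp only; omega, ?_⟩, ?_, ?_⟩
  · have h1 := hf e (hπP e he)
    have h2 := Nat.mul_le_mul_left (P * X * q) (hb e)
    dsimp only
    omega
  · intro e₁ he₁ e₂ he₂ hne hv h
    refine hfne e₁ e₂ (hπP _ he₁) (hπP _ he₂) (hπne e₁ he₁ e₂ he₂ hne hv) ?_
    have h1 := congrArg (· % (P * X * q)) h
    simp only [Nat.add_mul_mod_self_left] at h1
    have h2 := Nat.ModEq.add_left_cancel' 1 h1
    exact Nat.ModEq.eq_of_lt_of_lt h2 ((hf e₁ (hπP _ he₁)).trans_le hM)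
      ((hf e₂ (hπP _ he₂)).trans_le hM)
  · intro u v h0 hdist
    have hreach : G.Reachable u v := by
      by_contra h
      rw [SimpleGraph.dist_eq_zero_of_not_reachable h] at h0
      exact h0.false
    have hedist : G.edist u v ≤ (r + 1 : ℕ) := by
      rw [← hreach.coe_dist_eq_edist]
      exact_mod_cast hdist
    have huv : u ≠ v := by
      rintro rfl
      simp at h0
    rcases lt_or_gt_of_ne (hρ.ne huv) with h | h
    · exact hmain u v h (by rwa [SimpleGraph.edist_comm])
    · exact (hmain v u h hedist).symm

end Combination

section Parameters

theorem pow_three_le_exp {q : ℝ} (hq : 8 ^ 8 ≤ q) : q ^ 3 ≤ Real.exp (q / 8) := by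
  have h := Real.pow_div_factorial_le_exp (q / 8) (by linarith) 4
  refine le_trans ?_ h
  have h2 : (q / 8) ^ 4 / (Nat.factorial 4 : ℕ) = q ^ 3 * (q / 98304) := by
    norm_num [Nat.factorial]
    ring
  rw [h2]
  refine le_mul_of_one_le_right (by positivity) ?_
  rw [one_le_div (by norm_num)]
  linarith

theorem mul_pow_four_le_exp {q : ℝ} (hq : 8 ^ 8 ≤ q) : 64 * q ^ 4 ≤ Real.exp (q / 4) := by
  have h1 : Real.exp (q / 4) = Real.exp (q / 8) ^ 2 := by
    rw [← Real.exp_nat_mul]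
    congr 1
    push_cast
    ring
  have h2 := pow_le_pow_left₀ (by positivity) (pow_three_le_exp hq) 2
  have h3 : 64 * q ^ 4 ≤ (q ^ 3) ^ 2 := by
    have h4 : (64 : ℝ) ≤ q ^ 2 := by nlinarith
    have : 0 ≤ q ^ 4 := by positivity
    nlinarith
  rw [h1]
  exact h3.trans h2

theorem mul_exp_neg_le_one {Δ δ q : ℝ} {s : ℕ} (hq : 8 ^ 8 ≤ q) (hqs : 2048 * (2 * s + 3) ≤ q)
    (hΔ0 : 0 ≤ Δ) (hΔ : Δ ≤ Real.exp (q / 4)) (hδ : q ^ 7 ≤ δ) :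
    16 * (Δ + 1) ^ (3 * s + 3) * (q ^ 2 + q)
      * Real.exp (-((1 / (8 * q)) ^ 2 * (δ / (16 * (q ^ 2 + q))))) ≤ 1 := by
  have hq0 : 0 < q := by linarith
  have h64 := mul_pow_four_le_exp hq
  have h1 : Δ + 1 ≤ Real.exp (q / 2) := by
    have h2 : Real.exp (q / 2) = Real.exp (q / 4) * Real.exp (q / 4) := by
      rw [← Real.exp_add]
      congr 1
      ring
    have h3 : 2 ≤ Real.exp (q / 4) := by
      refine le_trans ?_ h64
      have : (1 : ℝ) ≤ q ^ 4 := one_le_pow₀ (by linarith)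
      linarith
    rw [h2]
    nlinarith
  have h2 : 16 * (q ^ 2 + q) ≤ Real.exp q := by
    have h3 : Real.exp (q / 4) ≤ Real.exp q := Real.exp_le_exp.2 (by linarith)
    refine le_trans ?_ (h64.trans h3)
    have h4 : (1 : ℝ) ≤ q ^ 2 := one_le_pow₀ (by linarith)
    have h5 : q ≤ q ^ 2 := by nlinarith
    have h6 : q ^ 4 = q ^ 2 * q ^ 2 := by ring
    nlinarith
  have h3 : q ^ 3 / 2048 ≤ (1 / (8 * q)) ^ 2 * (δ / (16 * (q ^ 2 + q))) := by
    have h4 : q ^ 2 + q ≤ 2 * q ^ 2 := by nlinarith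
    have h5 : 0 ≤ δ := le_trans (by positivity) hδ
    calc q ^ 3 / 2048 = (1 / (8 * q)) ^ 2 * (q ^ 7 / (16 * (2 * q ^ 2))) := by
          field_simp
          norm_num
      _ ≤ _ := by gcongr
  have h4 : (q / 2) * (3 * s + 3 : ℕ) + q ≤ q ^ 3 / 2048 := by
    have h5 : q ≤ q ^ 2 := by nlinarith
    have h6 : (2048 * (2 * s + 3)) * q ≤ q ^ 2 * q :=
      mul_le_mul_of_nonneg_right (hqs.trans h5) hq0.le
    have h7 : (0 : ℝ) ≤ s := Nat.cast_nonneg s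
    have h8 : 0 ≤ s * q := by positivity
    push_cast
    nlinarith
  calc 16 * (Δ + 1) ^ (3 * s + 3) * (q ^ 2 + q)
        * Real.exp (-((1 / (8 * q)) ^ 2 * (δ / (16 * (q ^ 2 + q)))))
      = (Δ + 1) ^ (3 * s + 3) * (16 * (q ^ 2 + q))
        * Real.exp (-((1 / (8 * q)) ^ 2 * (δ / (16 * (q ^ 2 + q))))) := by ring
    _ ≤ Real.exp (q / 2) ^ (3 * s + 3) * Real.exp q
        * Real.exp (-((q / 2) * (3 * s + 3 : ℕ) + q)) := by
        have := h4.trans h3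
        gcongr
    _ = 1 := by
        rw [← Real.exp_nat_mul, ← Real.exp_add, ← Real.exp_add, Real.exp_eq_one_iff]
        ring

theorem add_one_pow_mul_le {Δ : ℝ} {s : ℕ} (hΔ : 0 ≤ Δ) :
    (Δ + 1) ^ s * (1 - s / (Δ + 1)) ≤ Δ ^ s := by
  have h1 := one_add_mul_le_pow (a := -(1 / (Δ + 1))) (by
    have : 1 / (Δ + 1) ≤ 1 := by
      rw [div_le_one (by linarith)]
      linarith
    linarith) s
  calc (Δ + 1) ^ s * (1 - s / (Δ + 1)) = (Δ + 1) ^ s * (1 + s * -(1 / (Δ + 1))) := by ring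
    _ ≤ (Δ + 1) ^ s * (1 + -(1 / (Δ + 1))) ^ s := by gcongr
    _ = Δ ^ s := by
      rw [← mul_pow]
      congr 1
      field_simp
      ring

/-- The palette size obtained from the parameters is below the claimed bound. -/
theorem palette_lt {Δ q D : ℝ} {s : ℕ} (hs : 3 ≤ s) (hq : 100 ≤ q) (hqs : s ≤ q)
    (hΔ : q ^ 3 ≤ Δ) (hD : D ≤ 2 * ((Δ + 1) ^ s * (1 + 4 / q)) + 2 * Δ * q) :
    2 * D * (1 + 1 / q) + 4 * Δ ^ 2 < 4 * Δ ^ s * (1 + 6 / q) := by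
  have hq0 : 0 < q := by linarith
  have hq3 : 0 < q ^ 3 := by positivity
  have hqq : q ≤ q ^ 3 := le_self_pow₀ (by linarith) (by norm_num)
  have hΔ0 : 1 ≤ Δ := by linarith
  obtain ⟨y, hy⟩ : ∃ y, y = 1 / q := ⟨_, rfl⟩
  have hy0 : 0 < y := by rw [hy]; positivity
  have hy1 : y ≤ 1 / 100 := by rw [hy]; exact one_div_le_one_div_of_le (by norm_num) hq
  have hyq : y * q = 1 := by rw [hy]; field_simp
  have e4 : 4 / q = 4 * y := by rw [hy]; ring
  have e6 : 6 / q = 6 * y := by rw [hy]; ring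
  set R := (Δ + 1) ^ s with hR
  set T := Δ ^ s with hT
  have hT0 : 0 < T := by positivity
  have hR0 : 0 < R := by positivity
  have hRT : R * (1 - y ^ 2) ≤ T := by
    refine le_trans (mul_le_mul_of_nonneg_left ?_ hR0.le)
      (add_one_pow_mul_le (s := s) (by linarith))
    have : s / (Δ + 1) ≤ y ^ 2 := by
      rw [div_le_iff₀ (by linarith), hy, one_div, inv_pow, ← div_eq_inv_mul,
        le_div_iff₀ (by positivity)]
      nlinarith [sq_nonneg q]
    linarith
  have hRT' : R ≤ T * (1 + 2 * y ^ 2) := by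
    have hy2 : 0 ≤ 1 - 2 * y ^ 2 := by nlinarith
    have : T * 1 ≤ T * ((1 + 2 * y ^ 2) * (1 - y ^ 2)) :=
      mul_le_mul_of_nonneg_left (by nlinarith [mul_nonneg (sq_nonneg y) hy2]) hT0.le
    have h2 : R * (1 - y ^ 2) ≤ (T * (1 + 2 * y ^ 2)) * (1 - y ^ 2) := by linarith
    exact le_of_mul_le_mul_right h2 (by nlinarith)
  have hΔT : Δ ^ 2 ≤ T * y ^ 3 := by
    have h1 : Δ ^ 3 ≤ T := pow_le_pow_right₀ hΔ0 hs
    have h2 : Δ ^ 2 * q ^ 3 ≤ T := by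
      refine le_trans ?_ h1
      nlinarith [sq_nonneg Δ]
    have h3 : Δ ^ 2 = Δ ^ 2 * q ^ 3 * y ^ 3 := by
      rw [mul_assoc, ← mul_pow, mul_comm q, hyq]
      ring
    rw [h3]
    gcongr
  have hΔq : Δ * q ≤ Δ ^ 2 := by nlinarith
  rw [e4] at hD
  rw [e6, ← hy]
  have h1 : 2 * D * (1 + y) ≤ 4 * R * (1 + 5 * y + 4 * y ^ 2) + 8 * Δ ^ 2 := by
    have : 2 * D * (1 + y) ≤ 2 * (2 * (R * (1 + 4 * y)) + 2 * Δ * q) * (1 + y) := by gcongr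
    have h2 : Δ * q * (1 + y) ≤ 2 * Δ ^ 2 := by
      have : 0 ≤ Δ * q := by positivity
      nlinarith
    nlinarith
  have h2 : 4 * R * (1 + 5 * y + 4 * y ^ 2)
      ≤ 4 * (T * (1 + 2 * y ^ 2)) * (1 + 5 * y + 4 * y ^ 2) := by gcongr
  have h3 : (1 + 2 * y ^ 2) * (1 + 5 * y + 4 * y ^ 2) + 3 * y ^ 3 < 1 + 6 * y := by
    have hy2 : y ^ 2 ≤ 1 / 100 * y := by nlinarith
    have hy3 : y ^ 3 ≤ 1 / 100 * y := by nlinarith [sq_nonneg y]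
    have hy4 : y ^ 4 ≤ 1 / 100 * y := by nlinarith [sq_nonneg y, pow_pos hy0 3]
    nlinarith
  have h4 := mul_lt_mul_of_pos_left h3 hT0
  nlinarith

theorem layering_exp_le_one {Δ δ κ η : ℝ} {s : ℕ} (hΔ : 0 ≤ Δ) (hδ : 0 ≤ δ) (hκ : 0 < κ)
    (hexp : 16 * (Δ + 1) ^ (3 * s + 3) * κ * Real.exp (-(η ^ 2 * (δ / (16 * κ)))) ≤ 1) :
    8 * ((Δ + 1) ^ (2 * (s + 1)) * κ) * Real.exp (-(η ^ 2 * (δ / κ) / 4)) ≤ 1 := by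
  refine le_trans ?_ hexp
  have h1 : (Δ + 1) ^ (2 * (s + 1)) ≤ (Δ + 1) ^ (3 * s + 3) :=
    pow_le_pow_right₀ (by linarith) (by omega)
  have h2 : η ^ 2 * (δ / (16 * κ)) ≤ η ^ 2 * (δ / κ) / 4 := by
    have h3 : δ / (16 * κ) = δ / κ / 16 := by rw [div_div, mul_comm]
    have h4 : 0 ≤ η ^ 2 * (δ / κ) := by positivity
    rw [h3]
    linarith
  rw [← mul_assoc]
  gcongr
  norm_num

theorem coloring_exp_le_one {Δ δ κ η R D : ℝ} {s : ℕ} (hΔ : 0 ≤ Δ) (hδ : 0 ≤ δ) (hκ : 0 < κ)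
    (hD : 0 < D) (hR : R = (Δ + 1) ^ s) (hDR : D ≤ 4 * R)
    (hexp : 16 * (Δ + 1) ^ (3 * s + 3) * κ * Real.exp (-(η ^ 2 * (δ / (16 * κ)))) ≤ 1) :
    4 * ((Δ + 1) ^ (2 * s + 3) * (κ * D)) * Real.exp (-(η ^ 2 * (δ * R / (κ * D)) / 4)) ≤ 1 := by
  refine le_trans ?_ hexp
  have h1 : η ^ 2 * (δ / (16 * κ)) ≤ η ^ 2 * (δ * R / (κ * D)) / 4 := by
    rw [mul_div_assoc]
    refine mul_le_mul_of_nonneg_left ?_ (by positivity)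
    rw [div_div, div_le_div_iff₀ (by positivity) (by positivity)]
    have := mul_le_mul_of_nonneg_left hDR (show 0 ≤ 4 * δ * κ by positivity)
    linarith
  have h2 : 4 * ((Δ + 1) ^ (2 * s + 3) * (κ * D)) ≤ 16 * (Δ + 1) ^ (3 * s + 3) * κ := by
    have h3 : (Δ + 1) ^ (3 * s + 3) = (Δ + 1) ^ (2 * s + 3) * R := by
      rw [hR, ← pow_add]
      congr 1
      omega
    rw [h3]
    have := mul_le_mul_of_nonneg_left hDR (show 0 ≤ 4 * ((Δ + 1) ^ (2 * s + 3) * κ) by positivity)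
    linarith
  gcongr

theorem two_mul_cube_mul_le {q R D : ℝ} (hq : 8 ≤ q) (hR : 0 ≤ R)
    (hD : 2 * (R * (1 + 4 / q)) ≤ D) :
    2 * ((1 + 1 / (8 * q)) ^ 3 * R) ≤ (1 - 2 / q) * D := by
  have hq0 : 0 < q := by linarith
  obtain ⟨x, hx⟩ : ∃ x : ℝ, x = 1 / (8 * q) := ⟨_, rfl⟩
  have e1 : 2 / q = 16 * x := by rw [hx]; field_simp; norm_num
  have e2 : 4 / q = 32 * x := by rw [hx]; field_simp; norm_num
  have hx0 : 0 ≤ x := by rw [hx]; positivity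
  have hx1 : x ≤ 1 / 64 := by rw [hx]; exact one_div_le_one_div_of_le (by norm_num) (by linarith)
  rw [e2] at hD
  rw [← hx, e1]
  have h1 : (1 + x) ^ 3 ≤ (1 - 16 * x) * (1 + 32 * x) := by
    nlinarith [sq_nonneg x, mul_nonneg hx0 (sub_nonneg.2 hx1)]
  have h2 := mul_le_mul_of_nonneg_right h1 (show 0 ≤ 2 * R by positivity)
  have h3 := mul_le_mul_of_nonneg_left hD (show 0 ≤ 1 - 16 * x by linarith)
  linarith

end Parameters

theorem distSumDistIndex_lt_of_bounds {V : Type*} [Fintype V] [DecidableEq V] (G : SimpleGraph V)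
    [DecidableRel G.Adj] {s q : ℕ} (hs : 3 ≤ s) (hq : 8 ^ 8 ≤ q) (hqs : 2048 * (2 * s + 3) ≤ q)
    (hΔq : (q : ℝ) ^ 3 ≤ G.maxDegree) (hΔ : (G.maxDegree : ℝ) ≤ Real.exp (q / 4))
    (hδ : (q : ℝ) ^ 7 ≤ G.minDegree) :
    (distSumDistIndex G (s + 1) : ℝ) < 4 * (G.maxDegree : ℝ) ^ s * (1 + 6 / q) := by
  have hq' : (8 : ℝ) ^ 8 ≤ q := by exact_mod_cast hq
  have hqs' : 2048 * (2 * (s : ℝ) + 3) ≤ q := by exact_mod_cast hqs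
  have hq0 : (0 : ℝ) < q := by linarith
  have hs0 : (0 : ℝ) ≤ s := Nat.cast_nonneg s
  set Δ := G.maxDegree with hΔdef
  have hqq : (q : ℝ) ≤ (q : ℝ) ^ 3 := le_self_pow₀ (by linarith) (by norm_num)
  have hqΔ : (q : ℝ) ≤ Δ := hqq.trans hΔq
  have hΔ0 : (0 : ℝ) < Δ := by linarith
  have hΔn : 0 < Δ := by exact_mod_cast hΔ0
  obtain ⟨R, hR⟩ : ∃ R : ℝ, R = (Δ + 1) ^ s := ⟨_, rfl⟩
  have hΔ3 : (Δ : ℝ) ^ 3 ≤ R := by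
    rw [hR]
    exact (pow_le_pow_left₀ hΔ0.le (by linarith) 3).trans (pow_le_pow_right₀ (by linarith) hs)
  have hR0 : 0 < R := lt_of_lt_of_le (by positivity) hΔ3
  obtain ⟨X, hX⟩ : ∃ X, X = ⌈2 * (R * (1 + 4 / q)) / (2 * Δ * q)⌉₊ := ⟨_, rfl⟩
  have hX1 : 2 * (R * (1 + 4 / q)) ≤ 2 * Δ * X * q := by
    have := Nat.le_ceil (2 * (R * (1 + 4 / q)) / (2 * Δ * q))
    rw [← hX, div_le_iff₀ (by positivity)] at this
    linarith
  have hX2 : 2 * Δ * X * q ≤ 2 * (R * (1 + 4 / q)) + 2 * Δ * q := by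
    have := (Nat.ceil_lt_add_one (a := 2 * (R * (1 + 4 / q)) / (2 * Δ * q)) (by positivity)).le
    rw [← hX] at this
    have h2 := mul_le_mul_of_nonneg_right this (show 0 ≤ 2 * (Δ : ℝ) * q by positivity)
    rw [add_mul, div_mul_cancel₀ _ (by positivity)] at h2
    linarith
  have hX0 : 0 < X := by
    rw [hX, Nat.ceil_pos]
    positivity
  have hXR : (Δ : ℝ) ^ 2 ≤ X * q := by
    have h1 : Δ * (Δ : ℝ) ^ 2 ≤ Δ * (X * q) := by
      have h2 : R ≤ R * (1 + 4 / q) :=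
        le_mul_of_one_le_right hR0.le (le_add_of_nonneg_right (by positivity))
      nlinarith
    exact le_of_mul_le_mul_left h1 hΔ0
  have hDR : 2 * Δ * X * q ≤ 4 * R := by
    have h1 : 4 / (q : ℝ) ≤ 1 / 2 := by
      rw [div_le_div_iff₀ hq0 two_pos]
      linarith
    have h2 : R * (4 / q) ≤ R * (1 / 2) := mul_le_mul_of_nonneg_left h1 hR0.le
    have h3 : 2 * (Δ : ℝ) * q ≤ R := by
      refine le_trans ?_ hΔ3
      have : 2 * (q : ℝ) ≤ Δ ^ 2 := by nlinarith
      nlinarith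
    linarith
  have hM : 2 * (2 * Δ * X) + 2 * Δ * (2 * Δ) ≤ 2 * Δ * X * q := by
    have h1 : 2 * (X : ℝ) + 2 * Δ ≤ X * q := by
      have : (0 : ℝ) < X := by exact_mod_cast hX0
      nlinarith
    have h2 : 2 * X + 2 * Δ ≤ X * q := by exact_mod_cast h1
    have h3 := Nat.mul_le_mul_left (2 * Δ) h2
    linarith
  have : NeZero (2 * Δ) := ⟨by omega⟩
  have : NeZero X := ⟨by omega⟩
  obtain ⟨κ, hκ⟩ : ∃ κ : ℝ, κ = (q : ℝ) ^ 2 + q := ⟨_, rfl⟩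
  have hκ0 : 0 < κ := by rw [hκ]; positivity
  have hκq : ((q ^ 2 + q : ℕ) : ℝ) = κ := by rw [hκ]; push_cast; rfl
  have hexp := mul_exp_neg_le_one hq' hqs' hΔ0.le hΔ hδ
  rw [← hκ] at hexp
  set δ : ℝ := (G.minDegree : ℝ) with hδdef
  have hδ0 : 0 < δ := lt_of_lt_of_le (by positivity) hδ
  have hdist : DistSumDistinguishing G (s + 1)
      (2 * (2 * Δ * X * q) + (2 * (2 * Δ * X) + 2 * Δ * (2 * Δ))) := by
    refine distSumDistinguishing_of_bounds G (δ := δ) (by omega) le_rfl hM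
      (fun v => Nat.cast_le.2 (G.minDegree_le_degree v)) ?_ (mul_pow_four_le_exp hq') ?_ ?_ ?_
    · rw [hκq, ← mul_div_assoc, le_div_iff₀ hκ0]
      have h1 : 1 / (8 * (q : ℝ)) ≤ 1 / 2 := one_div_le_one_div_of_le two_pos (by linarith)
      have h2 : (q : ℝ) ^ 4 * κ ≤ 1 / 2 * (q : ℝ) ^ 7 := by
        rw [hκ]
        have h3 : (q : ℝ) ^ 2 + q ≤ 1 / 2 * (q : ℝ) ^ 3 := by nlinarith
        have h4 := mul_le_mul_of_nonneg_left h3 (show 0 ≤ (q : ℝ) ^ 4 by positivity)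
        nlinarith
      refine h2.trans (mul_le_mul (by linarith) hδ (by positivity) (by linarith))
    · rw [hκq]
      exact layering_exp_le_one hΔ0.le hδ0.le hκ0 hexp
    · rw [hκq, ← hR]
      push_cast
      exact coloring_exp_le_one hΔ0.le hδ0.le hκ0 (by positivity) hR hDR hexp
    · rw [← hR]
      push_cast
      exact two_mul_cube_mul_le (by linarith) hR0.le hX1
  have hle : distSumDistIndex G (s + 1) ≤ _ := Nat.sInf_le hdist
  have hle' : (distSumDistIndex G (s + 1) : ℝ)
      ≤ ((2 * (2 * Δ * X * q) + (2 * (2 * Δ * X) + 2 * Δ * (2 * Δ)) : ℕ) : ℝ) := by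
    exact_mod_cast hle
  have hpal := palette_lt hs (show (100 : ℝ) ≤ q by linarith) (show (s : ℝ) ≤ q by linarith) hΔq
    (hR ▸ hX2)
  refine (hle'.trans (le_of_eq ?_)).trans_lt hpal
  push_cast
  field_simp
  ring

theorem distSumDistIndex_lt_of_minDegree_ge (r : ℕ) (hr : 4 ≤ r) :
    ∃ Δ₀ : ℝ, ∀ (V : Type) [Fintype V] [DecidableEq V],
      ∀ (G : SimpleGraph V) [DecidableRel G.Adj],
      Δ₀ ≤ (G.maxDegree : ℝ) →
      (Real.log G.maxDegree) ^ 8 ≤ (G.minDegree : ℝ) →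
      (distSumDistIndex G r : ℝ) <
        4 * (G.maxDegree : ℝ) ^ (r - 1) * (1 + 3 / (2 * Real.log G.maxDegree)) + 384 := by
  obtain ⟨s, rfl⟩ : ∃ s, r = s + 1 := ⟨r - 1, by omega⟩
  refine ⟨Real.exp ((8 ^ 8 + 2048 * (2 * s + 3) : ℕ)), fun V _ _ G _ hΔ₀ hδ => ?_⟩
  have hΔ0 : (0 : ℝ) < G.maxDegree := (Real.exp_pos _).trans_le hΔ₀
  set L := Real.log G.maxDegree with hL
  have hL1 : ((8 ^ 8 + 2048 * (2 * s + 3) : ℕ) : ℝ) ≤ L := (Real.le_log_iff_exp_le hΔ0).2 hΔ₀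
  have hΔL : Real.exp L = G.maxDegree := Real.exp_log hΔ0
  have hs0 : (0 : ℝ) ≤ s := Nat.cast_nonneg s
  have hL8 : (8 : ℝ) ^ 8 ≤ L := by
    push_cast at hL1
    linarith
  have hL0 : 0 < L := by linarith
  obtain ⟨q, hq⟩ : ∃ q, q = ⌈4 * L⌉₊ := ⟨_, rfl⟩
  have hq1 : 4 * L ≤ q := hq ▸ Nat.le_ceil _
  have hq2 : (q : ℝ) ≤ 8 * L := by
    have := (Nat.ceil_lt_add_one (a := 4 * L) (by linarith)).le
    rw [← hq] at this
    linarith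
  have hqL : 8 ^ 8 + 2048 * (2 * s + 3) ≤ q := by
    have : ((8 ^ 8 + 2048 * (2 * s + 3) : ℕ) : ℝ) ≤ q := by linarith
    exact_mod_cast this
  have hq8 : (8 : ℝ) ^ 8 ≤ q := by linarith
  have hbound := distSumDistIndex_lt_of_bounds G (s := s) (q := q) (by omega)
    ((Nat.le_add_right _ _).trans hqL) ((Nat.le_add_left _ _).trans hqL)
    (by
      rw [← hΔL]
      exact (pow_three_le_exp hq8).trans (Real.exp_le_exp.2 (by linarith)))
    (by
      rw [← hΔL]
      exact Real.exp_le_exp.2 (by linarith))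
    (by
      refine le_trans ?_ hδ
      have h1 := pow_le_pow_left₀ (Nat.cast_nonneg q) hq2 8
      have h2 : (q : ℝ) ^ 7 * 8 ^ 8 ≤ (q : ℝ) ^ 7 * q := by gcongr
      rw [mul_pow] at h1
      have h3 : (q : ℝ) ^ 8 = (q : ℝ) ^ 7 * q := by ring
      linarith)
  have hqL' : 6 / (q : ℝ) ≤ 3 / (2 * L) := by
    rw [div_le_div_iff₀ (by linarith) (by linarith)]
    linarith
  rw [Nat.add_sub_cancel]
  have h4 : 4 * (G.maxDegree : ℝ) ^ s * (1 + 6 / q)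
      ≤ 4 * (G.maxDegree : ℝ) ^ s * (1 + 3 / (2 * L)) := by gcongr
  linarith
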